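/- arXiv:1706.09233 — 2 statements merged into one kernel-verified Lean document; each statement's English description precedes it below -/
import Mathlib

section
/- Let 0 < c ≤ π, σ² > 0, α ≥ 3 and μ ≥ 4. Then the function ψ(d,u) = (σ²/(1+|u|))·(1 − d·(1+|u|)^{1/α}/c)₊^μ, for (d,u) ∈ [0,π] × ℝ, is a geodesically isotropic, temporally symmetric covariance function on 𝕊³ × ℝ; that is, the kernel ((s₁,t₁),(s₂,t₂)) ↦ ψ(d_GC(s₁,s₂), t₁ − t₂) is positive definite on 𝕊³ × ℝ. In particular, for each fixed temporal lag u the spatial margin is compactly supported with support c·(1+|u|)^{−1/α}, which shrinks as |u| increases. -/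
open scoped RealInnerProductSpace

noncomputable def gcDist {n : ℕ} (x y : EuclideanSpace ℝ (Fin n)) : ℝ :=
  Real.arccos ⟪x, y⟫

def IsPosDefKernel {X : Type*} (K : X → X → ℝ) : Prop :=
  ∀ (N : ℕ) (x : Fin N → X) (c : Fin N → ℝ),
    0 ≤ ∑ i : Fin N, ∑ j : Fin N, c i * c j * K (x i) (x j)

namespace AskeyAux

open Finset MeasureTheory Filter Topology

theorem pd_add {X : Type*} {K L : X → X → ℝ} (hK : IsPosDefKernel K) (hL : IsPosDefKernel L) :
    IsPosDefKernel (fun x y => K x y + L x y) := by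
  intro N x c
  have h := add_nonneg (hK N x c) (hL N x c)
  rw [← sum_add_distrib] at h
  refine h.trans_eq (sum_congr rfl fun i _ => ?_)
  rw [← sum_add_distrib]
  exact sum_congr rfl fun j _ => by ring

theorem pd_smul {X : Type*} {K : X → X → ℝ} {a : ℝ} (ha : 0 ≤ a) (hK : IsPosDefKernel K) :
    IsPosDefKernel (fun x y => a * K x y) := by
  intro N x c
  have h := mul_nonneg ha (hK N x c)
  rw [mul_sum] at h
  refine h.trans_eq (sum_congr rfl fun i _ => ?_)
  rw [mul_sum]
  exact sum_congr rfl fun j _ => by ring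

theorem pd_sum {X ι : Type*} {K : ι → X → X → ℝ} (s : Finset ι)
    (hK : ∀ i ∈ s, IsPosDefKernel (K i)) :
    IsPosDefKernel (fun x y => ∑ i ∈ s, K i x y) := by
  classical
  induction s using Finset.induction_on with
  | empty => intro N x c; simp
  | insert a s ha ih =>
    have h := pd_add (hK a (mem_insert_self _ _))
      (ih fun i hi => hK i (mem_insert_of_mem hi))
    simpa only [sum_insert ha] using h

theorem pd_rank_one {X : Type*} (f : X → ℝ) : IsPosDefKernel (fun x y => f x * f y) := by
  intro N x c
  have : ∑ i, ∑ j, c i * c j * (f (x i) * f (x j)) = (∑ i, c i * f (x i)) ^ 2 := by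
    rw [sq, sum_mul_sum]
    exact sum_congr rfl fun i _ => sum_congr rfl fun j _ => by ring
  rw [this]; positivity

theorem pd_limit {X : Type*} {K : ℕ → X → X → ℝ} {L : X → X → ℝ}
    (hK : ∀ n, IsPosDefKernel (K n))
    (hL : ∀ x y, Tendsto (fun n => K n x y) atTop (𝓝 (L x y))) :
    IsPosDefKernel L := by
  intro N x c
  refine ge_of_tendsto' (f := fun n => ∑ i, ∑ j, c i * c j * K n (x i) (x j)) (x := atTop) ?_
    (fun n => hK n N x c)
  exact tendsto_finsetSum _ fun i _ => tendsto_finsetSum _ fun j _ => (hL _ _).const_mul _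

theorem posSemidef_of_pd {X : Type*} {K : X → X → ℝ} (hK : IsPosDefKernel K)
    (hs : ∀ x y, K x y = K y x) {N : ℕ} (x : Fin N → X) :
    (Matrix.of fun i j => K (x i) (x j)).PosSemidef := by
  rw [Matrix.posSemidef_iff_dotProduct_mulVec]
  refine ⟨?_, fun c => ?_⟩
  · ext i j; simp [hs (x j) (x i)]
  · have := hK N x c
    refine this.trans_eq ?_
    simp only [dotProduct, Matrix.mulVec, Matrix.of_apply, Pi.star_apply, star_trivial, mul_sum]
    exact sum_congr rfl fun i _ => sum_congr rfl fun j _ => by ring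

theorem pd_mul {X : Type*} {K L : X → X → ℝ} (hK : IsPosDefKernel K) (hL : IsPosDefKernel L)
    (hKs : ∀ x y, K x y = K y x) (hLs : ∀ x y, L x y = L y x) :
    IsPosDefKernel (fun x y => K x y * L x y) := by
  intro N x c
  have h := (posSemidef_of_pd hK hKs x).hadamard (posSemidef_of_pd hL hLs x)
  rw [Matrix.posSemidef_iff_dotProduct_mulVec] at h
  have := h.2 c
  refine this.trans_eq ?_
  simp only [dotProduct, Matrix.mulVec, Matrix.of_apply, Matrix.hadamard_apply, Pi.star_apply,
    star_trivial, mul_sum]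
  exact sum_congr rfl fun i _ => sum_congr rfl fun j _ => by ring

theorem pd_comap {X Y : Type*} {K : Y → Y → ℝ} (hK : IsPosDefKernel K) (f : X → Y) :
    IsPosDefKernel (fun x y => K (f x) (f y)) := fun N x c => hK N (fun i => f (x i)) c

/-- Triangle functions are positive definite on the line. -/
theorem pd_triangle (b : ℝ) : IsPosDefKernel (fun s t : ℝ => max (b - |s - t|) 0) := by
  have key : ∀ s t : ℝ, max (b - |s - t|) 0 =
      ∫ z, (Set.Icc s (s + b)).indicator (fun _ => (1 : ℝ)) z *
        (Set.Icc t (t + b)).indicator (fun _ => (1 : ℝ)) z := by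
    intro s t
    have : (fun z => (Set.Icc s (s + b)).indicator (fun _ => (1 : ℝ)) z *
        (Set.Icc t (t + b)).indicator (fun _ => (1 : ℝ)) z) =
        (Set.Icc (max s t) (min (s + b) (t + b))).indicator (fun _ => (1 : ℝ)) := by
      rw [← Set.Icc_inter_Icc]
      funext z
      rw [← Set.inter_indicator_mul]
      simp
    rw [this, integral_indicator measurableSet_Icc]
    simp only [integral_const, smul_eq_mul, mul_one, measureReal_restrict_apply_univ]
    rw [Real.volume_real_Icc]
    congr 1
    rcases le_total s t with h | h
    · rw [max_eq_right h, min_eq_left (by linarith), abs_of_nonpos (by linarith)]; ring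
    · rw [max_eq_left h, min_eq_right (by linarith), abs_of_nonneg (by linarith)]; ring
  have hIntg : ∀ s t : ℝ, Integrable (fun z => (Set.Icc s (s + b)).indicator (fun _ => (1 : ℝ)) z *
        (Set.Icc t (t + b)).indicator (fun _ => (1 : ℝ)) z) := by
    intro s t
    have : (fun z => (Set.Icc s (s + b)).indicator (fun _ => (1 : ℝ)) z *
        (Set.Icc t (t + b)).indicator (fun _ => (1 : ℝ)) z) =
        (Set.Icc (max s t) (min (s + b) (t + b))).indicator (fun _ => (1 : ℝ)) := by
      rw [← Set.Icc_inter_Icc]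
      funext z
      rw [← Set.inter_indicator_mul]
      simp
    rw [this, integrable_indicator_iff measurableSet_Icc]
    exact integrableOn_const (by simp)
  intro N x c
  have : ∑ i, ∑ j, c i * c j * max (b - |x i - x j|) 0 =
      ∫ z, ∑ i, ∑ j, c i * c j * ((Set.Icc (x i) (x i + b)).indicator (fun _ => (1 : ℝ)) z *
        (Set.Icc (x j) (x j + b)).indicator (fun _ => (1 : ℝ)) z) := by
    rw [integral_finsetSum _ fun i _ => integrable_finsetSum _ fun j _ => (hIntg _ _).const_mul _]
    refine sum_congr rfl fun i _ => ?_
    rw [integral_finsetSum _ fun j _ => (hIntg _ _).const_mul _]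
    refine sum_congr rfl fun j _ => ?_
    rw [integral_const_mul, key]
  rw [this]
  refine integral_nonneg fun z => ?_
  exact pd_rank_one (fun s => (Set.Icc s (s + b)).indicator (fun _ => (1 : ℝ)) z) N x c

/-- Finite form of the Polya criterion. -/
theorem polya_finite (S : Finset ℝ) : ∀ φ : ℝ → ℝ, (∀ u ∈ S, 0 ≤ φ u) →
    (∀ u ∈ S, ∀ v ∈ S, u ≤ v → φ v ≤ φ u) →
    (∀ u ∈ S, ∀ v ∈ S, ∀ w ∈ S, u < v → v < w →
      (φ v - φ u) * (w - v) ≤ (φ w - φ v) * (v - u)) →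
    ∃ F : ℝ → ℝ, IsPosDefKernel (fun s t : ℝ => F |s - t|) ∧ (∀ u ∈ S, F u = φ u) ∧
      (∀ y ∈ S, (∀ z ∈ S, z ≤ y) → ∀ u, y ≤ u → F u = φ y) := by
  induction S using Finset.induction_on_max with
  | empty =>
    intro φ _ _ _
    exact ⟨fun _ => 0, by intro N x c; simp, by simp, by simp⟩
  | insert x S hx ih =>
    intro φ h0 h1 h2
    have hxm : x ∈ insert x S := mem_insert_self _ _
    have hm : ∀ u ∈ S, u ∈ insert x S := fun u hu => mem_insert_of_mem hu
    rcases S.eq_empty_or_nonempty with rfl | hne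
    · refine ⟨fun _ => φ x, ?_, by simp, by simp⟩
      have := pd_smul (h0 x hxm) (pd_rank_one (fun _ : ℝ => (1 : ℝ)))
      simpa using this
    · set y := S.max' hne with hy
      have hyS : y ∈ S := S.max'_mem hne
      have hle : ∀ z ∈ S, z ≤ y := fun z hz => S.le_max' z hz
      have hyx : y < x := hx y hyS
      set s := (φ y - φ x) / (x - y) with hs
      have hs0 : 0 ≤ s := div_nonneg (by linarith [h1 y (hm y hyS) x hxm hyx.le]) (by linarith)
      have hsy : s * (x - y) = φ y - φ x := by rw [hs]; field_simp [sub_ne_zero.2 hyx.ne']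
      have hsn : ∀ u ∈ S, 0 ≤ φ u - φ x - s * (x - u) := by
        intro u hu
        rcases (hle u hu).eq_or_lt with rfl | hlt
        · linarith
        · have := h2 u (hm u hu) y (hm y hyS) x hxm hlt hyx
          have h3 : φ x - φ y = - s * (x - y) := by linarith
          rw [h3] at this
          have h4 : (φ y - φ u) ≤ - s * (y - u) := by
            have : (φ y - φ u) * (x - y) ≤ (- s * (y - u)) * (x - y) := by linarith
            exact le_of_mul_le_mul_right this (by linarith)
          linarith
      have hc : ∀ u ∈ S, ∀ v ∈ S, ∀ w ∈ S, u < v → v < w →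
          ((φ v - φ x - s * (x - v)) - (φ u - φ x - s * (x - u))) * (w - v) ≤
          ((φ w - φ x - s * (x - w)) - (φ v - φ x - s * (x - v))) * (v - u) := by
        intro u hu v hv w hw huv hvw
        have := h2 u (hm u hu) v (hm v hv) w (hm w hw) huv hvw
        linarith
      obtain ⟨F, hF, hFS, hFy⟩ := ih (fun u => φ u - φ x - s * (x - u)) hsn (by
        intro u hu v hv huv
        rcases huv.eq_or_lt with rfl | huv
        · exact le_rfl
        rcases (hle v hv).eq_or_lt with rfl | hlt
        · have := hsn u hu
          show φ y - φ x - s * (x - y) ≤ _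
          linarith
        · have h3 := hc u hu v hv y hyS huv hlt
          have h5 := hsn v hv
          have h4 : ((φ v - φ x - s * (x - v)) - (φ u - φ x - s * (x - u))) * (y - v) ≤ 0 := by
            refine h3.trans (mul_nonpos_of_nonpos_of_nonneg ?_ (by linarith))
            linarith
          have := nonpos_of_mul_nonpos_left h4 (by linarith)
          show φ v - φ x - s * (x - v) ≤ φ u - φ x - s * (x - u)
          linarith) hc
      have hFge : ∀ u, y ≤ u → F u = 0 := by
        intro u hu
        have := hFy y hyS hle u hu
        beta_reduce at this
        linarith
      refine ⟨fun u => F u + (φ x + s * max (x - u) 0), ?_, ?_, ?_⟩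
      · refine pd_add hF (pd_add ?_ (pd_smul hs0 (pd_triangle x)))
        have := pd_smul (h0 x hxm) (pd_rank_one (fun _ : ℝ => (1 : ℝ)))
        simpa using this
      · intro u hu
        rcases mem_insert.1 hu with rfl | hu
        · simp [hFge u hyx.le]
        · simp only [hFS u hu]
          rw [max_eq_left (by linarith [hx u hu])]; ring
      · intro z hz hzm u hzu
        have hzx : z = x := by
          rcases mem_insert.1 hz with rfl | hz
          · rfl
          · exact absurd (hzm x hxm) (not_le.2 (hx z hz))
        subst hzx
        simp only [hFge u (by linarith)]
        rw [max_eq_right (by linarith)]; ring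

theorem polya (φ : ℝ → ℝ) (h0 : ∀ u, 0 ≤ u → 0 ≤ φ u) (h1 : AntitoneOn φ (Set.Ici 0))
    (h2 : ConvexOn ℝ (Set.Ici 0) φ) : IsPosDefKernel (fun s t : ℝ => φ |s - t|) := by
  classical
  intro N x c
  set S : Finset ℝ := (univ : Finset (Fin N × Fin N)).image (fun p => |x p.1 - x p.2|) with hS
  have hpos : ∀ u ∈ S, 0 ≤ u := by
    intro u hu
    rw [hS, mem_image] at hu
    obtain ⟨p, -, rfl⟩ := hu
    exact abs_nonneg _
  obtain ⟨F, hF, hFS, -⟩ := polya_finite S φ (fun u hu => h0 u (hpos u hu))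
    (fun u hu v hv huv => h1 (hpos u hu) (hpos v hv) huv) (by
      intro u hu v hv w hw huv hvw
      have := h2.slope_mono_adjacent (hpos u hu) (hpos w hw) huv hvw
      rwa [div_le_div_iff₀ (by linarith) (by linarith)] at this)
  have := hF N x c
  convert this using 5 with i _ j _
  exact (hFS _ (by rw [hS, mem_image]; exact ⟨(i, j), mem_univ _, rfl⟩)).symm

end AskeyAux
namespace AskeyAux

open Finset MeasureTheory Filter Topology Polynomial

/-- Coefficients of the symmetric power representation of `2 × 2` matrices. -/
noncomputable def gp (a b c d : ℂ) (k m : ℕ) : ℂ[X] := (C a * X + C b) ^ k * (C c * X + C d) ^ m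

noncomputable def tr (a b c d : ℂ) (n : ℕ) : ℂ :=
  ∑ p ∈ antidiagonal n, (gp a b c d p.1 p.2).coeff p.1

theorem gp_lin (a b : ℂ) (p : ℂ[X]) (i : ℕ) :
    ((C a * X + C b) * p).coeff (i + 1) = a * p.coeff i + b * p.coeff (i + 1) := by
  rw [add_mul, coeff_add, mul_assoc, coeff_C_mul, coeff_X_mul, coeff_C_mul]

theorem gp_lin_zero (a b : ℂ) (p : ℂ[X]) :
    ((C a * X + C b) * p).coeff 0 = b * p.coeff 0 := by
  rw [add_mul, coeff_add, mul_assoc, coeff_C_mul, coeff_X_mul_zero, coeff_C_mul]; ring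

theorem gp_succ_left (a b c d : ℂ) (k m : ℕ) :
    gp a b c d (k + 1) m = (C a * X + C b) * gp a b c d k m := by
  unfold gp; ring

theorem gp_succ_right (a b c d : ℂ) (k m : ℕ) :
    gp a b c d k (m + 1) = (C c * X + C d) * gp a b c d k m := by
  unfold gp; ring

theorem gp_diag_rec (a b c d : ℂ) (k m : ℕ) :
    (gp a b c d (k + 1) (m + 1)).coeff (k + 1) =
      a * (gp a b c d k (m + 1)).coeff k + d * (gp a b c d (k + 1) m).coeff (k + 1)
        - (a * d - b * c) * (gp a b c d k m).coeff k := by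
  rw [gp_succ_right a b c d (k + 1) m, gp_succ_left, gp_succ_right a b c d k m]
  rw [gp_lin, gp_lin]
  cases k with
  | zero => rw [gp_lin_zero, gp_lin_zero]; ring
  | succ k => rw [gp_lin, gp_lin]; ring

theorem gp_zero_right (a b c d : ℂ) (k : ℕ) : (gp a b c d k 0).coeff k = a ^ k := by
  induction k with
  | zero => simp [gp]
  | succ k ih =>
    rw [gp_succ_left, gp_lin, ih]
    have : (gp a b c d k 0).coeff (k + 1) = 0 := by
      apply coeff_eq_zero_of_natDegree_lt
      unfold gp
      have h1 : ((C a * X + C b) ^ k).natDegree ≤ k * 1 :=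
        natDegree_pow_le_of_le k natDegree_linear_le
      simp only [pow_zero, mul_one]
      omega
    rw [this]; ring

theorem gp_zero_left (a b c d : ℂ) (m : ℕ) : (gp a b c d 0 m).coeff 0 = d ^ m := by
  induction m with
  | zero => simp [gp]
  | succ k ih => rw [gp_succ_right, gp_lin_zero, ih]; ring

theorem tr_rec (a b c d : ℂ) (n : ℕ) :
    tr a b c d (n + 2) = (a + d) * tr a b c d (n + 1) - (a * d - b * c) * tr a b c d n := by
  have e1 : tr a b c d (n + 2) = d ^ (n + 2) + a ^ (n + 2) +
      ∑ p ∈ antidiagonal n, (gp a b c d (p.1 + 1) (p.2 + 1)).coeff (p.1 + 1) := by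
    unfold tr
    rw [Nat.sum_antidiagonal_succ, Nat.sum_antidiagonal_succ']
    rw [gp_zero_left, gp_zero_right]
    ring
  have e2 : tr a b c d (n + 1) = d ^ (n + 1) +
      ∑ p ∈ antidiagonal n, (gp a b c d (p.1 + 1) p.2).coeff (p.1 + 1) := by
    unfold tr
    rw [Nat.sum_antidiagonal_succ]
    rw [gp_zero_left]
  have e3 : tr a b c d (n + 1) = a ^ (n + 1) +
      ∑ p ∈ antidiagonal n, (gp a b c d p.1 (p.2 + 1)).coeff p.1 := by
    unfold tr
    rw [Nat.sum_antidiagonal_succ']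
    rw [gp_zero_right]
  rw [e1, sum_congr rfl fun p _ => gp_diag_rec a b c d p.1 p.2, sum_sub_distrib,
    sum_add_distrib, ← mul_sum, ← mul_sum, ← mul_sum]
  have e4 : tr a b c d n = ∑ p ∈ antidiagonal n, (gp a b c d p.1 p.2).coeff p.1 := rfl
  rw [← e4]
  linear_combination (-a) * e3 - d * e2

theorem tr_zero (a b c d : ℂ) : tr a b c d 0 = 1 := by simp [tr, gp]

theorem tr_one (a b c d : ℂ) : tr a b c d 1 = a + d := by
  unfold tr
  rw [Nat.sum_antidiagonal_succ]
  have h := gp_zero_right a b c d 1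
  have h' := gp_zero_left a b c d 1
  simp only [HasAntidiagonal.antidiagonal_zero, Finset.sum_singleton, zero_add]
  rw [h, h']; ring

theorem tr_eq_U (a b c d : ℂ) (t : ℝ) (ht : a + d = 2 * t) (hdet : a * d - b * c = 1) (n : ℕ) :
    tr a b c d n = (((Chebyshev.U ℝ n).eval t : ℝ) : ℂ) := by
  induction n using Nat.twoStepInduction with
  | zero => simp [tr_zero]
  | one => simp [tr_one, ht]
  | more n h1 h2 =>
    rw [tr_rec, h1, h2, ht, hdet]
    push_cast
    rw [Chebyshev.U_add_two]
    simp

theorem gram_left (p q : ℂ[X]) (n i : ℕ) (hi : i ≤ n) :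
    ((X * C p + C q : ℂ[X][X]) ^ n).coeff i = C (n.choose i : ℂ) * (p ^ i * q ^ (n - i)) := by
  rw [add_pow, finsetSum_coeff]
  have l : ∀ k ∈ range (n + 1), ((X * C p) ^ k * C q ^ (n - k) *
        ((n.choose k : ℕ) : ℂ[X][X])).coeff i =
      if k = i then C (n.choose i : ℂ) * (p ^ i * q ^ (n - i)) else 0 := by
    intro k _
    have h1 : ((n.choose k : ℕ) : ℂ[X][X]) = C (C (n.choose k : ℂ)) := by simp
    have : (X * C p) ^ k * C q ^ (n - k) * ((n.choose k : ℕ) : ℂ[X][X]) =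
        C (C (n.choose k : ℂ) * (p ^ k * q ^ (n - k))) * X ^ k := by
      rw [h1, C_mul, C_mul, C_pow, C_pow]; ring
    rw [this, coeff_C_mul_X_pow]
    by_cases h : k = i
    · subst h; simp only [if_true]
    · rw [if_neg (Ne.symm h), if_neg h]
  rw [sum_congr rfl l, sum_ite_eq', if_pos (by simp; omega)]

theorem gram_right (p q u v : ℂ[X]) (n i : ℕ) :
    (((p.map C * C u + q.map C * C v : ℂ[X][X]) ^ n).coeff i).coeff i =
      ∑ k ∈ range (n + 1), (n.choose k : ℂ) * ((p ^ k * q ^ (n - k)).coeff i *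
        (u ^ k * v ^ (n - k)).coeff i) := by
  rw [add_pow, finsetSum_coeff, finsetSum_coeff]
  refine sum_congr rfl fun k _ => ?_
  have h1 : ((n.choose k : ℕ) : ℂ[X][X]) = C (C (n.choose k : ℂ)) := by simp
  have : (p.map C * C u) ^ k * (q.map C * C v) ^ (n - k) * ((n.choose k : ℕ) : ℂ[X][X]) =
      ((p ^ k * q ^ (n - k)).map C) * C (C (n.choose k : ℂ) * (u ^ k * v ^ (n - k))) := by
    rw [h1, Polynomial.map_mul, Polynomial.map_pow, Polynomial.map_pow, C_mul, C_mul, C_pow, C_pow]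
    ring
  rw [this, coeff_mul_C, coeff_map, coeff_C_mul, coeff_C_mul]
  ring

theorem gp_gram (x1 x2 x3 x4 y1 y2 y3 y4 : ℂ) (n i : ℕ) (hi : i ≤ n) :
    (n.choose i : ℂ) * (gp (x1 * y1 + x3 * y3) (x1 * y2 + x3 * y4) (x2 * y1 + x4 * y3)
        (x2 * y2 + x4 * y4) i (n - i)).coeff i =
      ∑ k ∈ range (n + 1), (n.choose k : ℂ) * ((gp x1 x2 x3 x4 k (n - k)).coeff i *
        (gp y1 y2 y3 y4 k (n - k)).coeff i) := by
  have key : (X * C (C (x1 * y1 + x3 * y3) * X + C (x1 * y2 + x3 * y4)) +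
      C (C (x2 * y1 + x4 * y3) * X + C (x2 * y2 + x4 * y4)) : ℂ[X][X]) =
      (((C x1 * X + C x2 : ℂ[X]).map C) * C (C y1 * X + C y2 : ℂ[X]) +
        ((C x3 * X + C x4 : ℂ[X]).map C) * C (C y3 * X + C y4 : ℂ[X])) := by
    simp only [Polynomial.map_add, Polynomial.map_mul, map_C, map_X, C_add, C_mul]
    ring
  unfold gp
  rw [← gram_right, ← key, gram_left _ _ _ _ hi, coeff_C_mul]

theorem tr_gram (x1 x2 x3 x4 y1 y2 y3 y4 : ℂ) (n : ℕ) :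
    tr (x1 * y1 + x3 * y3) (x1 * y2 + x3 * y4) (x2 * y1 + x4 * y3) (x2 * y2 + x4 * y4) n =
      ∑ i ∈ range (n + 1), ∑ k ∈ range (n + 1), ((n.choose k / n.choose i : ℝ) : ℂ) *
        ((gp x1 x2 x3 x4 k (n - k)).coeff i * (gp y1 y2 y3 y4 k (n - k)).coeff i) := by
  unfold tr
  rw [Nat.sum_antidiagonal_eq_sum_range_succ
    (fun i j => (gp (x1 * y1 + x3 * y3) (x1 * y2 + x3 * y4) (x2 * y1 + x4 * y3)
      (x2 * y2 + x4 * y4) i j).coeff i)]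
  refine sum_congr rfl fun i hi => ?_
  have hi' : i ≤ n := by simp at hi; omega
  have h := gp_gram x1 x2 x3 x4 y1 y2 y3 y4 n i hi'
  have hne : (n.choose i : ℂ) ≠ 0 := by exact_mod_cast (Nat.choose_pos hi').ne'
  rw [← mul_right_inj' hne, h, mul_sum]
  refine sum_congr rfl fun k _ => ?_
  push_cast
  field_simp

theorem gp_conj (a b c d : ℂ) (k m i : ℕ) :
    (gp (star a) (star b) (star c) (star d) k m).coeff i = star ((gp a b c d k m).coeff i) := by
  have : gp (star a) (star b) (star c) (star d) k m = (gp a b c d k m).map (starRingEnd ℂ) := by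
    simp [gp]
  rw [this, coeff_map]; rfl

/-- positivity of real part of complex rank one kernels -/
theorem pd_complex {X : Type*} (f : X → ℂ) : IsPosDefKernel (fun x y => (star (f x) * f y).re) := by
  have := pd_add (pd_rank_one (fun x => (f x).re)) (pd_rank_one (fun x => (f x).im))
  convert this using 3 with x y
  simp

theorem pd_U (n : ℕ) : IsPosDefKernel
    (fun x y : Metric.sphere (0 : EuclideanSpace ℝ (Fin 4)) 1 =>
      (Chebyshev.U ℝ n).eval ⟪(x : EuclideanSpace ℝ (Fin 4)), (y : EuclideanSpace ℝ (Fin 4))⟫) := by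
  let A : Metric.sphere (0 : EuclideanSpace ℝ (Fin 4)) 1 → ℂ := fun x => ⟨x.1 0, x.1 1⟩
  let B : Metric.sphere (0 : EuclideanSpace ℝ (Fin 4)) 1 → ℂ := fun x => ⟨x.1 2, x.1 3⟩
  have hn : ∀ x, star (A x) * A x + star (B x) * B x = 1 := by
    intro x
    have h : ‖(x : EuclideanSpace ℝ (Fin 4))‖ = 1 := by simp
    have h2 : ‖(x : EuclideanSpace ℝ (Fin 4))‖ ^ 2 = 1 := by rw [h]; norm_num
    rw [EuclideanSpace.norm_sq_eq] at h2
    simp only [Fin.sum_univ_four, Real.norm_eq_abs, sq_abs] at h2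
    apply Complex.ext
    · simp [A, B]; linarith
    · simp [A, B]; ring
  let G : ℕ → ℕ → Metric.sphere (0 : EuclideanSpace ℝ (Fin 4)) 1 → ℂ := fun k i x =>
    (gp (A x) (B x) (-star (B x)) (star (A x)) k (n - k)).coeff i
  have key : ∀ x y : Metric.sphere (0 : EuclideanSpace ℝ (Fin 4)) 1,
      (Chebyshev.U ℝ n).eval ⟪(x : EuclideanSpace ℝ (Fin 4)), (y : EuclideanSpace ℝ (Fin 4))⟫ =
      ∑ i ∈ range (n + 1), ∑ k ∈ range (n + 1), (n.choose k / n.choose i : ℝ) *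
        (star (G k i x) * G k i y).re := by
    intro x y
    have h1 := tr_gram (star (A x)) (star (B x)) (star (-star (B x))) (star (star (A x)))
      (A y) (B y) (-star (B y)) (star (A y)) n
    rw [tr_eq_U _ _ _ _ ⟪(x : EuclideanSpace ℝ (Fin 4)), (y : EuclideanSpace ℝ (Fin 4))⟫] at h1
    · have h2 := congrArg Complex.re h1
      rw [Complex.ofReal_re] at h2
      rw [h2, Complex.re_sum]
      refine sum_congr rfl fun i _ => ?_
      rw [Complex.re_sum]
      refine sum_congr rfl fun k _ => ?_
      rw [Complex.re_ofReal_mul, gp_conj]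
    · rw [PiLp.inner_apply]
      simp only [Fin.sum_univ_four]
      apply Complex.ext
      · simp [A, B]; ring
      · simp [A, B]; ring
    · have hx := hn x
      have hy := hn y
      simp only [star_neg, star_star]
      linear_combination (star (A y) * A y + star (B y) * B y) * hx + hy
  have h := pd_sum (range (n + 1)) (fun i _ => pd_sum (range (n + 1)) (fun k _ =>
    pd_smul (a := (n.choose k / n.choose i : ℝ)) (by positivity) (pd_complex (G k i))))
  simpa only [← key] using h

end AskeyAux
namespace AskeyAux

open Finset MeasureTheory Filter Topology Polynomial

theorem cos_series {θ : ℝ} (h0 : 0 ≤ θ) (h1 : θ ≤ 2 * Real.pi) :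
    HasSum (fun n : ℕ => 1 / (n : ℝ) ^ 2 * Real.cos (n * θ))
      (Real.pi ^ 2 / 6 - Real.pi * θ / 2 + θ ^ 2 / 4) := by
  have hpi := Real.pi_pos
  have h := hasSum_one_div_nat_pow_mul_cos (k := 1) one_ne_zero (x := θ / (2 * Real.pi))
    ⟨by positivity, by rw [div_le_one (by positivity)]; exact h1⟩
  have e := bernoulliFun_two (θ / (2 * Real.pi))
  unfold bernoulliFun at e
  rw [show 2 * 1 = 2 from rfl, e] at h
  convert! h using 1
  · funext n
    congr 2
    field_simp
  · simp only [Nat.factorial]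
    push_cast
    field_simp
    ring

theorem sin_series {θ : ℝ} (h0 : 0 ≤ θ) (h1 : θ ≤ 2 * Real.pi) :
    HasSum (fun n : ℕ => 1 / (n : ℝ) ^ 3 * Real.sin (n * θ))
      (θ ^ 3 / 12 - Real.pi * θ ^ 2 / 4 + Real.pi ^ 2 * θ / 6) := by
  have hpi := Real.pi_pos
  have h := hasSum_one_div_nat_pow_mul_sin (k := 1) one_ne_zero (x := θ / (2 * Real.pi))
    ⟨by positivity, by rw [div_le_one (by positivity)]; exact h1⟩
  have e : ∀ x : ℝ, (Polynomial.map (algebraMap ℚ ℝ) (Polynomial.bernoulli 3)).eval x =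
      x ^ 3 - 3 / 2 * x ^ 2 + x / 2 := by
    intro x
    have hb : _root_.bernoulli 3 = 0 := by
      rw [bernoulli_eq_bernoulli'_of_ne_one (by norm_num), bernoulli'_three]
    simp only [Polynomial.bernoulli, Finset.sum_range_succ, Finset.sum_range_zero,
      Polynomial.map_add, Polynomial.map_monomial, eval_add, eval_monomial, hb,
      _root_.bernoulli_one, _root_.bernoulli_two, _root_.bernoulli_zero]
    norm_num [Nat.choose]
    ring
  rw [show 2 * 1 + 1 = 3 from rfl, e] at h
  convert! h using 1
  · funext n
    congr 2
    field_simp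
  · simp only [Nat.factorial]
    push_cast
    field_simp
    ring

theorem fourier_series {ξ θ : ℝ} (hξ0 : 0 < ξ) (hξ : ξ ≤ Real.pi) (h0 : 0 ≤ θ)
    (h1 : θ ≤ Real.pi) :
    HasSum (fun n : ℕ => 4 / Real.pi * (ξ / (n : ℝ) ^ 2 - Real.sin (n * ξ) / (n : ℝ) ^ 3) *
      Real.cos (n * θ)) ((max (ξ - θ) 0) ^ 2 - ξ ^ 3 / (3 * Real.pi)) := by
  have hpi := Real.pi_pos
  have c := cos_series h0 (by linarith)
  have s1 := sin_series (θ := ξ + θ) (by linarith) (by linarith)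
  have s2 : HasSum (fun n : ℕ => 1 / (n : ℝ) ^ 3 * Real.sin (n * (ξ - θ)))
      ((ξ - θ) ^ 3 / 12 - Real.pi * (ξ - θ) * |ξ - θ| / 4 + Real.pi ^ 2 * (ξ - θ) / 6) := by
    rcases le_total θ ξ with h | h
    · have := sin_series (θ := ξ - θ) (by linarith) (by linarith)
      rw [abs_of_nonneg (by linarith)]
      convert! this using 2; ring
    · have := (sin_series (θ := θ - ξ) (by linarith) (by linarith)).neg
      rw [abs_of_nonpos (by linarith)]
      convert! this using 1
      · funext n
        rw [show (n : ℝ) * (ξ - θ) = - (n * (θ - ξ)) by ring, Real.sin_neg]; ring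
      · ring
  have h := ((c.mul_left ξ).sub ((s1.add s2).mul_left (1 / 2))).mul_left (4 / Real.pi)
  convert! h using 1
  · funext n
    have : Real.sin (n * ξ) * Real.cos (n * θ) =
        1 / 2 * (Real.sin (n * (ξ + θ)) + Real.sin (n * (ξ - θ))) := by
      rw [show (n:ℝ) * (ξ + θ) = n * ξ + n * θ by ring,
        show (n:ℝ) * (ξ - θ) = n * ξ - n * θ by ring, Real.sin_add, Real.sin_sub]; ring
    linear_combination (-(4 / Real.pi) / (n : ℝ) ^ 3) * this
  · rcases le_total θ ξ with h | h
    · rw [max_eq_left (by linarith), abs_of_nonneg (by linarith)]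
      field_simp; ring
    · rw [max_eq_right (by linarith), abs_of_nonpos (by linarith)]
      field_simp; ring

theorem cusa {x : ℝ} (hx : 0 ≤ x) : 0 ≤ 2 * x + x * Real.cos x - 3 * Real.sin x := by
  by_cases h3 : 3 ≤ x
  · nlinarith [Real.sin_le_one x, Real.neg_one_le_cos x]
  push Not at h3
  have hd : ∀ y : ℝ, HasDerivAt (fun x => 2 * x + x * Real.cos x - 3 * Real.sin x)
      (2 * 1 + (1 * Real.cos y + y * (-Real.sin y)) - 3 * Real.cos y) y := fun y =>
    (((hasDerivAt_id y).const_mul 2).add ((hasDerivAt_id y).mul (Real.hasDerivAt_cos y))).sub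
      ((Real.hasDerivAt_sin y).const_mul 3)
  have hm : MonotoneOn (fun x => 2 * x + x * Real.cos x - 3 * Real.sin x) (Set.Icc 0 3) := by
    apply monotoneOn_of_deriv_nonneg (convex_Icc 0 3)
    · exact fun y _ => (hd y).continuousAt.continuousWithinAt
    · exact fun y _ => (hd y).differentiableAt.differentiableWithinAt
    · intro y hy
      rw [interior_Icc] at hy
      rw [(hd y).deriv]
      obtain ⟨z, rfl⟩ : ∃ z, y = 2 * z := ⟨y / 2, by ring⟩
      have hz0 : 0 < z := by linarith [hy.1]
      have hz1 : z < Real.pi / 2 := by linarith [hy.2, Real.pi_gt_three]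
      have hcos : 0 < Real.cos z := Real.cos_pos_of_mem_Ioo ⟨by linarith, hz1⟩
      have hsin : 0 < Real.sin z := Real.sin_pos_of_pos_of_lt_pi hz0 (by linarith)
      have ht := Real.lt_tan hz0 hz1
      rw [Real.tan_eq_sin_div_cos, lt_div_iff₀ hcos] at ht
      rw [Real.cos_two_mul, Real.sin_two_mul]
      have h1 := Real.sin_sq_add_cos_sq z
      nlinarith [mul_pos hsin (sub_pos.2 ht)]
  have := hm (Set.left_mem_Icc.2 (by norm_num)) ⟨hx, h3.le⟩ hx
  simpa using this

theorem sin_ge_cubic {x : ℝ} (hx : 0 ≤ x) : x - x ^ 3 / 6 ≤ Real.sin x := by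
  have hd : ∀ y : ℝ, HasDerivAt (fun x => Real.sin x - (x - x ^ 3 / 6))
      (Real.cos y - (1 - (3 : ℕ) * y ^ 2 / 6)) y := fun y => by
    have := (hasDerivAt_pow 3 y).div_const 6
    exact (Real.hasDerivAt_sin y).sub ((hasDerivAt_id y).sub this)
  have hm : Monotone (fun x => Real.sin x - (x - x ^ 3 / 6)) := by
    apply monotone_of_deriv_nonneg
    · exact fun y => (hd y).differentiableAt
    · intro y
      rw [(hd y).deriv]
      have := Real.one_sub_sq_div_two_le_cos (x := y)
      push_cast; linarith
  have := hm hx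
  simp only [Real.sin_zero] at this
  linarith

noncomputable def wf (x : ℝ) : ℝ := (x - Real.sin x) / x ^ 3

theorem wf_nonneg {x : ℝ} (hx : 0 ≤ x) : 0 ≤ wf x :=
  div_nonneg (by linarith [Real.sin_le hx]) (by positivity)

theorem wf_le {x : ℝ} (hx : 0 < x) : wf x ≤ 1 / 6 := by
  unfold wf
  rw [div_le_iff₀ (by positivity)]
  linarith [sin_ge_cubic hx.le]

theorem wf_anti : AntitoneOn wf (Set.Ioi 0) := by
  have hd : ∀ y : ℝ, 0 < y → HasDerivAt wf
      (((1 - Real.cos y) * y ^ 3 - (y - Real.sin y) * ((3 : ℕ) * y ^ 2)) / (y ^ 3) ^ 2) y :=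
    fun y hy => ((hasDerivAt_id y).sub (Real.hasDerivAt_sin y)).div (hasDerivAt_pow 3 y)
      (by positivity)
  apply antitoneOn_of_deriv_nonpos (convex_Ioi 0)
  · exact fun y hy => (hd y hy).continuousAt.continuousWithinAt
  · intro y hy
    rw [interior_Ioi] at hy
    exact (hd y hy).differentiableAt.differentiableWithinAt
  · intro y hy
    rw [interior_Ioi] at hy
    have hy' : 0 < y := hy
    rw [(hd y hy).deriv]
    apply div_nonpos_of_nonpos_of_nonneg _ (by positivity)
    have := mul_nonneg (sq_nonneg y) (cusa hy'.le)
    push_cast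
    nlinarith

noncomputable def Ac (ξ : ℝ) (n : ℕ) : ℝ :=
  4 / Real.pi * (ξ / (n : ℝ) ^ 2 - Real.sin (n * ξ) / (n : ℝ) ^ 3)

theorem Ac_eq {ξ : ℝ} (hξ : 0 < ξ) {n : ℕ} (hn : n ≠ 0) :
    Ac ξ n = 4 / Real.pi * ξ ^ 3 * wf (n * ξ) := by
  unfold Ac wf
  have : (n : ℝ) ≠ 0 := by exact_mod_cast hn
  have hpi := Real.pi_pos
  field_simp

theorem Ac_zero (ξ : ℝ) : Ac ξ 0 = 0 := by simp [Ac]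

noncomputable def Ac' (ξ : ℝ) (n : ℕ) : ℝ :=
  if n = 0 then 2 * (ξ ^ 3 / (3 * Real.pi)) else Ac ξ n

theorem Ac'_nonneg {ξ : ℝ} (hξ : 0 < ξ) (n : ℕ) : 0 ≤ Ac' ξ n := by
  have hpi := Real.pi_pos
  unfold Ac'
  split_ifs with h
  · positivity
  · rw [Ac_eq hξ h]
    exact mul_nonneg (by positivity) (wf_nonneg (by positivity))

theorem Ac'_anti {ξ : ℝ} (hξ : 0 < ξ) (n : ℕ) : Ac' ξ (n + 2) ≤ Ac' ξ n := by
  have hpi := Real.pi_pos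
  unfold Ac'
  rw [if_neg (by omega), Ac_eq hξ (by omega)]
  split_ifs with h
  · have := wf_le (x := ((n + 2 : ℕ) : ℝ) * ξ) (by positivity)
    calc 4 / Real.pi * ξ ^ 3 * wf (((n + 2 : ℕ) : ℝ) * ξ) ≤ 4 / Real.pi * ξ ^ 3 * (1 / 6) := by
          gcongr
      _ = _ := by field_simp; ring
  · rw [Ac_eq hξ h]
    have hn : 0 < n := Nat.pos_of_ne_zero h
    have hn' : (0 : ℝ) < n := by exact_mod_cast hn
    refine mul_le_mul_of_nonneg_left (wf_anti ?_ ?_ ?_) (by positivity)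
    · exact mul_pos hn' hξ
    · show 0 < ((n + 2 : ℕ) : ℝ) * ξ
      positivity
    · push_cast; nlinarith

theorem partial_sum (ξ t : ℝ) (N : ℕ) :
    ξ ^ 3 / (3 * Real.pi) + ∑ n ∈ range (N + 2), Ac ξ n * (Chebyshev.T ℝ n).eval t =
      ∑ n ∈ range N, (Ac' ξ n - Ac' ξ (n + 2)) / 2 * (Chebyshev.U ℝ n).eval t
      + Ac' ξ N / 2 * (Chebyshev.U ℝ N).eval t
      + Ac' ξ (N + 1) / 2 * (Chebyshev.U ℝ (N + 1 : ℕ)).eval t := by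
  induction N with
  | zero =>
    simp [sum_range_succ, Ac_zero, Ac']
    ring
  | succ N ih =>
    rw [sum_range_succ, ← add_assoc, ih, sum_range_succ]
    have h := congrArg (eval t) (Chebyshev.two_mul_T_eq_U_sub_U ℝ N)
    simp only [eval_mul, eval_sub, eval_ofNat] at h
    have e : Ac ξ (N + 2) = Ac' ξ (N + 2) := by simp [Ac']
    rw [e]
    push_cast
    rw [show (N : ℤ) + 1 + 1 = N + 2 by ring, show N + 1 + 1 = N + 2 by ring]
    linear_combination (Ac' ξ (N + 2) / 2) * h

abbrev S3 := Metric.sphere (0 : EuclideanSpace ℝ (Fin 4)) 1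

theorem pd_space {ξ : ℝ} (hξ0 : 0 < ξ) (hξ : ξ ≤ Real.pi) : IsPosDefKernel
    (fun x y : S3 =>
      (max (ξ - gcDist (x : EuclideanSpace ℝ (Fin 4)) (y : EuclideanSpace ℝ (Fin 4))) 0) ^ 2) := by
  refine pd_limit (K := fun N (x y : S3) => ξ ^ 3 / (3 * Real.pi) + ∑ n ∈ range (N + 2), Ac ξ n *
    (Chebyshev.T ℝ n).eval ⟪(x : EuclideanSpace ℝ (Fin 4)), (y : EuclideanSpace ℝ (Fin 4))⟫) ?_ ?_
  · intro N
    simp only [partial_sum]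
    refine pd_add (pd_add (pd_sum _ fun n _ => pd_smul ?_ (pd_U n)) (pd_smul ?_ (pd_U N)))
      (pd_smul ?_ (pd_U (N + 1)))
    · linarith [Ac'_anti hξ0 n]
    · linarith [Ac'_nonneg hξ0 N]
    · linarith [Ac'_nonneg hξ0 (N + 1)]
  · intro x y
    have h := fourier_series hξ0 hξ (Real.arccos_nonneg
      ⟪(x : EuclideanSpace ℝ (Fin 4)), (y : EuclideanSpace ℝ (Fin 4))⟫) (Real.arccos_le_pi _)
    have h2 := ((tendsto_add_atTop_iff_nat 2).2 h.tendsto_sum_nat).const_add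
      (ξ ^ 3 / (3 * Real.pi))
    rw [add_sub_cancel] at h2
    refine h2.congr fun N => ?_
    congr 1
    refine sum_congr rfl fun n _ => ?_
    unfold Ac
    congr 1
    have hx : ‖(x : EuclideanSpace ℝ (Fin 4))‖ = 1 := by simp
    have hy : ‖(y : EuclideanSpace ℝ (Fin 4))‖ = 1 := by simp
    have hb := abs_real_inner_le_norm (x : EuclideanSpace ℝ (Fin 4)) (y : EuclideanSpace ℝ (Fin 4))
    rw [hx, hy, one_mul, abs_le] at hb
    have := Chebyshev.T_real_cos (Real.arccos
      ⟪(x : EuclideanSpace ℝ (Fin 4)), (y : EuclideanSpace ℝ (Fin 4))⟫) n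
    rw [Real.cos_arccos hb.1 hb.2] at this
    rw [this]
    simp

end AskeyAux
namespace AskeyAux

open Finset MeasureTheory Filter Topology

theorem convex_comp {T s : Set ℝ} {g f : ℝ → ℝ} (hg : ConvexOn ℝ T g) (hgm : MonotoneOn g T)
    (hf : ConvexOn ℝ s f) (hm : ∀ x ∈ s, f x ∈ T) : ConvexOn ℝ s (fun x => g (f x)) := by
  refine ⟨hf.1, fun x hx y hy a b ha hb hab => ?_⟩
  exact (hgm (hm _ (hf.1 hx hy ha hb hab)) (hg.1 (hm x hx) (hm y hy) ha hb hab)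
    (hf.2 hx hy ha hb hab)).trans (hg.2 (hm x hx) (hm y hy) ha hb hab)

theorem concave_shift {f : ℝ → ℝ} (hf : ConcaveOn ℝ (Set.Ioi 0) f) :
    ConcaveOn ℝ (Set.Ici 0) (fun u => f (1 + u)) := by
  refine ⟨convex_Ici 0, fun x hx y hy a b ha hb hab => ?_⟩
  have hx' : (0 : ℝ) ≤ x := hx
  have hy' : (0 : ℝ) ≤ y := hy
  have := hf.2 (x := 1 + x) (y := 1 + y) (show (0 : ℝ) < 1 + x by linarith)
    (show (0 : ℝ) < 1 + y by linarith) ha hb hab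
  refine this.trans_eq ?_
  show f _ = f _
  congr 1
  simp only [smul_eq_mul]
  linear_combination hab

theorem pd_time {c α γ ξ : ℝ} (hc : 0 < c) (hα : 3 ≤ α) (hγ : 1 ≤ γ) (hξ : 0 ≤ ξ) :
    IsPosDefKernel (fun s t : ℝ => (1 + |s - t|) ^ (-((α - 3) / α)) *
      max (1 - ξ * (1 + |s - t|) ^ (1 / α) / c) 0 ^ γ) := by
  have hβ : 0 ≤ (α - 3) / α := div_nonneg (by linarith) (by linarith)
  have hα1 : 0 ≤ 1 / α := by positivity
  have hα2 : 1 / α ≤ 1 := by rw [div_le_one (by linarith)]; linarith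
  -- first factor
  have c1 : ConvexOn ℝ (Set.Ici 0) (fun u : ℝ => (1 + u) ^ (-((α - 3) / α))) := by
    have h := concave_shift strictConcaveOn_log_Ioi.concaveOn
    have h' := (h.neg).smul hβ
    have h2 := convex_comp (convexOn_exp) (Real.exp_monotone.monotoneOn _) h'
      (fun _ _ => Set.mem_univ _)
    refine h2.congr ?_
    intro u hu
    have hu' : (0 : ℝ) ≤ u := hu
    show Real.exp ((α - 3) / α * -(Real.log (1 + u))) = (1 + u) ^ (-((α - 3) / α))
    rw [Real.rpow_def_of_pos (by linarith)]
    congr 1; ring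
  have a1 : AntitoneOn (fun u : ℝ => (1 + u) ^ (-((α - 3) / α))) (Set.Ici 0) := by
    intro u hu v hv huv
    have hu' : (0 : ℝ) ≤ u := hu
    exact Real.rpow_le_rpow_of_nonpos (by linarith) (by linarith) (by linarith)
  have n1 : ∀ ⦃u : ℝ⦄, u ∈ Set.Ici 0 → 0 ≤ (fun u : ℝ => (1 + u) ^ (-((α - 3) / α))) u := by
    intro u hu
    have hu' : (0 : ℝ) ≤ u := hu
    exact Real.rpow_nonneg (by linarith) _
  -- second factor
  have c2 : ConvexOn ℝ (Set.Ici 0) (fun u : ℝ => max (1 - ξ * (1 + u) ^ (1 / α) / c) 0) := by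
    have h := concave_shift ((Real.concaveOn_rpow hα1 hα2).subset Set.Ioi_subset_Ici_self
      (convex_Ioi 0))
    have h' := ((h.neg).smul (c := ξ / c) (by positivity)).add_const 1
    have h2 := h'.sup (convexOn_const 0 (convex_Ici 0))
    refine h2.congr ?_
    intro u hu
    show max (ξ / c * -((1 + u) ^ (1 / α)) + 1) 0 = _
    congr 1; ring
  have a2 : AntitoneOn (fun u : ℝ => max (1 - ξ * (1 + u) ^ (1 / α) / c) 0) (Set.Ici 0) := by
    intro u hu v hv huv
    have hu' : (0 : ℝ) ≤ u := hu
    have : (1 + u) ^ (1 / α) ≤ (1 + v) ^ (1 / α) :=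
      Real.rpow_le_rpow (by linarith) (by linarith) hα1
    show max _ _ ≤ max _ _
    gcongr
  have c3 := convex_comp (convexOn_rpow hγ)
    (fun x hx y _ hxy => Real.rpow_le_rpow hx hxy (by linarith)) c2
    (fun u _ => Set.mem_Ici.2 (le_max_right _ _))
  have n3 : ∀ ⦃u : ℝ⦄, u ∈ Set.Ici 0 →
      0 ≤ (fun u : ℝ => max (1 - ξ * (1 + u) ^ (1 / α) / c) 0 ^ γ) u := 
    fun u _ => Real.rpow_nonneg (le_max_right _ _) _
  have a3 : AntitoneOn (fun u : ℝ => max (1 - ξ * (1 + u) ^ (1 / α) / c) 0 ^ γ) (Set.Ici 0) :=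
    fun u hu v hv huv => Real.rpow_le_rpow (le_max_right _ _) (a2 hu hv huv) (by linarith)
  refine polya (fun u => (1 + u) ^ (-((α - 3) / α)) *
      max (1 - ξ * (1 + u) ^ (1 / α) / c) 0 ^ γ) ?_ ?_ ?_
  · exact fun u hu => mul_nonneg (n1 hu) (n3 hu)
  · exact fun u hu v hv huv => mul_le_mul (a1 hu hv huv) (a3 hu hv huv) (n3 hv) (n1 hu)
  · exact c1.mul c3 n1 n3 (a1.monovaryOn a3)

theorem mix_continuous (d h : ℝ) {γ : ℝ} (hγ : 1 ≤ γ) :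
    Continuous (fun ξ : ℝ => max (ξ - d) 0 ^ 2 * max (1 - ξ / h) 0 ^ γ) := by
  have : Continuous (fun ξ : ℝ => max (1 - ξ / h) 0 ^ γ) :=
    Continuous.rpow_const (by fun_prop) (fun _ => Or.inr (by linarith))
  fun_prop

theorem mixture {c d h γ : ℝ} (hd : 0 ≤ d) (hh : 0 < h) (hhc : h ≤ c) (hγ : 1 ≤ γ) :
    ∫ ξ in (0 : ℝ)..c, max (ξ - d) 0 ^ 2 * max (1 - ξ / h) 0 ^ γ =
      h ^ 3 * max (1 - d / h) 0 ^ (γ + 3) * ∫ v in (0 : ℝ)..1, v ^ 2 * (1 - v) ^ γ := by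
  have z1 : ∀ ξ, ξ ≤ d → max (ξ - d) 0 ^ 2 * max (1 - ξ / h) 0 ^ γ = 0 := by
    intro ξ hξ
    rw [max_eq_right (by linarith)]; simp
  have z2 : ∀ ξ, h ≤ ξ → max (ξ - d) 0 ^ 2 * max (1 - ξ / h) 0 ^ γ = 0 := by
    intro ξ hξ
    have : 1 ≤ ξ / h := by rwa [one_le_div hh]
    rw [max_eq_right (a := 1 - ξ / h) (by linarith), Real.zero_rpow (by linarith), mul_zero]
  rcases le_or_gt h d with hdh | hdh
  · have : (fun ξ : ℝ => max (ξ - d) 0 ^ 2 * max (1 - ξ / h) 0 ^ γ) = fun _ => 0 := by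
      funext ξ
      rcases le_total ξ d with h1 | h1
      · exact z1 ξ h1
      · exact z2 ξ (by linarith)
    rw [this]
    have h1 : 1 ≤ d / h := by rwa [one_le_div hh]
    rw [max_eq_right (by linarith), Real.zero_rpow (by linarith)]
    simp
  · have hcont := mix_continuous d h hγ
    have ii : ∀ a b : ℝ, IntervalIntegrable
      (fun ξ : ℝ => max (ξ - d) 0 ^ 2 * max (1 - ξ / h) 0 ^ γ) volume a b :=
      fun a b => hcont.intervalIntegrable a b
    rw [← intervalIntegral.integral_add_adjacent_intervals (ii 0 d) (ii d c),
      ← intervalIntegral.integral_add_adjacent_intervals (ii d h) (ii h c)]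
    have e1 : ∫ ξ in (0 : ℝ)..d, max (ξ - d) 0 ^ 2 * max (1 - ξ / h) 0 ^ γ = 0 := by
      rw [intervalIntegral.integral_congr (g := fun _ => (0 : ℝ))]
      · simp
      · intro ξ hξ
        rw [Set.uIcc_of_le hd] at hξ
        exact z1 ξ hξ.2
    have e2 : ∫ ξ in h..c, max (ξ - d) 0 ^ 2 * max (1 - ξ / h) 0 ^ γ = 0 := by
      rw [intervalIntegral.integral_congr (g := fun _ => (0 : ℝ))]
      · simp
      · intro ξ hξ
        rw [Set.uIcc_of_le hhc] at hξ
        exact z2 ξ hξ.1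
    rw [e1, e2, zero_add, add_zero]
    have e3 := intervalIntegral.smul_integral_comp_add_mul (a := 0) (b := 1)
      (fun ξ : ℝ => max (ξ - d) 0 ^ 2 * max (1 - ξ / h) 0 ^ γ) (h - d) d
    rw [show d + (h - d) * 0 = d by ring, show d + (h - d) * 1 = h by ring] at e3
    rw [← e3, smul_eq_mul, ← intervalIntegral.integral_const_mul,
      ← intervalIntegral.integral_const_mul]
    apply intervalIntegral.integral_congr
    intro v hv
    rw [Set.uIcc_of_le zero_le_one] at hv
    have hp : 0 < 1 - d / h := by rw [sub_pos, div_lt_one hh]; exact hdh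
    have f1 : max (d + (h - d) * v - d) 0 = (h - d) * v := by
      rw [max_eq_left]
      · ring
      · have := mul_nonneg (sub_nonneg.2 hdh.le) hv.1
        linarith
    have f2 : max (1 - (d + (h - d) * v) / h) 0 = (1 - d / h) * (1 - v) := by
      have : 1 - (d + (h - d) * v) / h = (1 - d / h) * (1 - v) := by field_simp; ring
      rw [this, max_eq_left (mul_nonneg hp.le (by linarith [hv.2]))]
    simp only
    rw [f1, f2, max_eq_left hp.le, Real.mul_rpow hp.le (by linarith [hv.2]),
      Real.rpow_add hp, show (3 : ℝ) = ((3 : ℕ) : ℝ) by norm_num, Real.rpow_natCast]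
    have : h - d = h * (1 - d / h) := by field_simp
    rw [this]; ring

theorem const_pos {γ : ℝ} (hγ : 1 ≤ γ) : 0 < ∫ v in (0 : ℝ)..1, v ^ 2 * (1 - v) ^ γ := by
  have hc : Continuous (fun v : ℝ => v ^ 2 * (1 - v) ^ γ) := by
    have : Continuous (fun v : ℝ => (1 - v) ^ γ) :=
      Continuous.rpow_const (by fun_prop) (fun _ => Or.inr (by linarith))
    fun_prop
  apply intervalIntegral.intervalIntegral_pos_of_pos_on (hc.intervalIntegrable _ _) _ one_pos
  intro v hv
  exact mul_pos (pow_pos hv.1 2) (Real.rpow_pos_of_pos (by linarith [hv.2]) _)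

end AskeyAux

theorem askey_shrinking_support_posdef
    (c σ2 α μ : ℝ) (hc0 : 0 < c) (hcpi : c ≤ Real.pi) (hσ : 0 < σ2)
    (hα : 3 ≤ α) (hμ : 4 ≤ μ) :
    IsPosDefKernel (fun p q : Metric.sphere (0 : EuclideanSpace ℝ (Fin 4)) 1 × ℝ =>
      σ2 / (1 + |p.2 - q.2|) *
        max (1 - gcDist (p.1 : EuclideanSpace ℝ (Fin 4)) (q.1 : EuclideanSpace ℝ (Fin 4))
              * (1 + |p.2 - q.2|) ^ (1 / α) / c) 0 ^ μ) := by
  set γ := μ - 3 with hγd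
  have hγ : 1 ≤ γ := by linarith
  set B := ∫ v in (0 : ℝ)..1, v ^ 2 * (1 - v) ^ γ with hB
  have hBpos : 0 < B := AskeyAux.const_pos hγ
  let D : AskeyAux.S3 × ℝ → AskeyAux.S3 × ℝ → ℝ := fun p q =>
    gcDist (p.1 : EuclideanSpace ℝ (Fin 4)) (q.1 : EuclideanSpace ℝ (Fin 4))
  let T : ℝ → AskeyAux.S3 × ℝ → AskeyAux.S3 × ℝ → ℝ := fun ξ p q =>
    (1 + |p.2 - q.2|) ^ (-((α - 3) / α)) * max (1 - ξ * (1 + |p.2 - q.2|) ^ (1 / α) / c) 0 ^ γ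
  have hDs : ∀ p q, D p q = D q p := fun p q => by
    simp only [D, gcDist, real_inner_comm]
  have hTs : ∀ ξ p q, T ξ p q = T ξ q p := fun ξ p q => by
    simp only [T, abs_sub_comm p.2 q.2]
  have hpd : ∀ ξ, 0 < ξ → ξ ≤ c →
      IsPosDefKernel (fun p q => max (ξ - D p q) 0 ^ 2 * T ξ p q) := by
    intro ξ h0 h1
    refine AskeyAux.pd_mul
      (AskeyAux.pd_comap (AskeyAux.pd_space h0 (h1.trans hcpi)) (fun p : AskeyAux.S3 × ℝ => p.1))
      (AskeyAux.pd_comap (AskeyAux.pd_time hc0 hα hγ h0.le) (fun p : AskeyAux.S3 × ℝ => p.2))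
      (fun p q => ?_) (fun p q => hTs ξ p q)
    show max (ξ - D p q) 0 ^ 2 = max (ξ - D q p) 0 ^ 2
    rw [hDs p q]
  have hx : ∀ u d ξ : ℝ, 0 ≤ u →
      max (ξ - d) 0 ^ 2 * ((1 + u) ^ (-((α - 3) / α)) *
        max (1 - ξ * (1 + u) ^ (1 / α) / c) 0 ^ γ) =
      (1 + u) ^ (-((α - 3) / α)) *
        (max (ξ - d) 0 ^ 2 * max (1 - ξ / (c * (1 + u) ^ (-(1 / α)))) 0 ^ γ) := by
    intro u d ξ hu
    have : ξ * (1 + u) ^ (1 / α) / c = ξ / (c * (1 + u) ^ (-(1 / α))) := by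
      have hp : 0 < (1 + u) ^ (1 / α) := Real.rpow_pos_of_pos (by linarith) _
      rw [Real.rpow_neg (by linarith)]
      field_simp
    rw [this]; ring
  have hcont : ∀ p q, Continuous (fun ξ => max (ξ - D p q) 0 ^ 2 * T ξ p q) := by
    intro p q
    have := fun ξ => hx |p.2 - q.2| (D p q) ξ (abs_nonneg _)
    simp only [T, this]
    exact (AskeyAux.mix_continuous _ _ hγ).const_mul _
  have hIntg : ∀ p q, ∫ ξ in (0 : ℝ)..c, max (ξ - D p q) 0 ^ 2 * T ξ p q =
      (c ^ 3 * B / σ2) * (σ2 / (1 + |p.2 - q.2|) *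
        max (1 - D p q * (1 + |p.2 - q.2|) ^ (1 / α) / c) 0 ^ μ) := by
    intro p q
    have h1 := fun ξ => hx |p.2 - q.2| (D p q) ξ (abs_nonneg _)
    simp only [T, h1]
    have hu : 0 ≤ |p.2 - q.2| := abs_nonneg _
    generalize |p.2 - q.2| = u at hu
    have hd : 0 ≤ D p q := Real.arccos_nonneg _
    generalize D p q = d at hd
    have hup : 0 < 1 + u := by linarith
    have hp : 0 < (1 + u) ^ (1 / α) := Real.rpow_pos_of_pos hup _
    have hle : (1 + u) ^ (-(1 / α)) ≤ 1 :=
      Real.rpow_le_one_of_one_le_of_nonpos (by linarith)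
        (by have : 0 ≤ 1 / α := by positivity
            linarith)
    rw [intervalIntegral.integral_const_mul,
      AskeyAux.mixture hd (mul_pos hc0 (Real.rpow_pos_of_pos hup _)) (by nlinarith) hγ, ← hB]
    have e1 : d / (c * (1 + u) ^ (-(1 / α))) = d * (1 + u) ^ (1 / α) / c := by
      rw [Real.rpow_neg hup.le]
      field_simp
    have e2 : (1 + u) ^ (-((α - 3) / α)) * ((1 + u) ^ (-(1 / α))) ^ 3 = 1 / (1 + u) := by
      have e0 : 1 / (1 + u) = (1 + u) ^ (-1 : ℝ) := by rw [Real.rpow_neg_one, one_div]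
      have hα0 : α ≠ 0 := by intro h; rw [h] at hα; norm_num at hα
      rw [e0, ← Real.rpow_natCast, ← Real.rpow_mul hup.le, ← Real.rpow_add hup]
      congr 1
      push_cast
      field_simp
      ring
    rw [e1, show γ + 3 = μ by rw [hγd]; ring, mul_pow]
    generalize max (1 - d * (1 + u) ^ (1 / α) / c) 0 ^ μ = M
    have e3 : c ^ 3 * B / σ2 * (σ2 / (1 + u) * M) = c ^ 3 * B * M * (1 / (1 + u)) := by
      field_simp
    rw [e3, ← e2]; ring
  intro N x w
  have hfin : 0 ≤ ∫ ξ in (0 : ℝ)..c, ∑ i, ∑ j, w i * w j *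
      (max (ξ - D (x i) (x j)) 0 ^ 2 * T ξ (x i) (x j)) := by
    rw [intervalIntegral.integral_of_le hc0.le]
    refine MeasureTheory.setIntegral_nonneg measurableSet_Ioc fun ξ hξ => ?_
    exact hpd ξ hξ.1 hξ.2 N x w
  have ii : ∀ i j, IntervalIntegrable (fun ξ => w i * w j *
      (max (ξ - D (x i) (x j)) 0 ^ 2 * T ξ (x i) (x j))) MeasureTheory.volume 0 c :=
    fun i j => ((hcont _ _).const_mul _).intervalIntegrable _ _
  have hii : ∀ i, IntervalIntegrable (fun ξ => ∑ j, w i * w j *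
      (max (ξ - D (x i) (x j)) 0 ^ 2 * T ξ (x i) (x j))) MeasureTheory.volume 0 c :=
    fun i => (continuous_finsetSum _ fun j _ => (hcont _ _).const_mul _).intervalIntegrable _ _
  rw [intervalIntegral.integral_finsetSum fun i _ => hii i] at hfin
  simp only [intervalIntegral.integral_finsetSum fun j (_ : j ∈ Finset.univ) => ii _ j,
    intervalIntegral.integral_const_mul, hIntg] at hfin
  have hk : 0 < c ^ 3 * B / σ2 := by positivity
  refine (mul_nonneg_iff_of_pos_left hk).1 ?_
  refine hfin.trans_eq ?_
  rw [Finset.mul_sum]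
  refine Finset.sum_congr rfl fun i _ => ?_
  rw [Finset.mul_sum]
  refine Finset.sum_congr rfl fun j _ => ?_
  simp only [D]
  ring
end

section
/- Let σ² > 0. Let f : [0,∞) → ℝ be completely monotonic with f(0) = 1, and let γ_T : ℝ → [1,∞) be continuous and even with γ_T(0) = 1, such that for every ξ > 0 the function u ↦ exp(−ξ·γ_T(u)) is positive definite on ℝ. Then ψ(d,u) = (σ²/γ_T(u)³)·f(d·γ_T(u)), for (d,u) ∈ [0,π] × ℝ, is a geodesically isotropic, temporally symmetric covariance function on 𝕊² × ℝ; that is, the kernel ((s₁,t₁),(s₂,t₂)) ↦ ψ(d_GC(s₁,s₂), t₁ − t₂) is positive definite on 𝕊² × ℝ. -/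
open scoped RealInnerProductSpace

/-- `f : ℝ → ℝ` is completely monotonic on `[0,∞)`: continuous on `[0,∞)`, infinitely
differentiable on `(0,∞)`, with `(-1)^j f^{(j)}(t) ≥ 0` for all `t > 0` and all `j`. -/
def CompletelyMonotonicOn (f : ℝ → ℝ) : Prop :=
  ContinuousOn f (Set.Ici 0) ∧ ContDiffOn ℝ (⊤ : ℕ∞) f (Set.Ioi 0) ∧
    ∀ (j : ℕ) (t : ℝ), 0 < t → 0 ≤ (-1 : ℝ) ^ j * iteratedDerivWithin j f (Set.Ioi 0) t

/-- Remainder of the Taylor expansion at `a` of the `j`-th function of a family. -/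
noncomputable def cmRem (F : ℕ → ℝ → ℝ) (a : ℝ) (K j : ℕ) (y : ℝ) : ℝ :=
  F j y - ∑ k ∈ Finset.range K, F (j + k) a * ((a - y) ^ k / (k.factorial : ℝ))

lemma cmRem_self (F : ℕ → ℝ → ℝ) (a : ℝ) (K j : ℕ) : cmRem F a (K + 1) j a = 0 := by
  unfold cmRem
  rw [Finset.sum_range_succ']
  simp

lemma cmRem_hasDerivAt (F : ℕ → ℝ → ℝ)
    (hd : ∀ j t, 0 < t → HasDerivAt (F j) (-(F (j + 1) t)) t) (a : ℝ) (K j : ℕ) (y : ℝ)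
    (hy : 0 < y) : HasDerivAt (cmRem F a (K + 1) j) (-(cmRem F a K (j + 1) y)) y := by
  have h1 : ∀ k : ℕ, HasDerivAt (fun y : ℝ => F (j + (k + 1)) a * ((a - y) ^ (k + 1) / ((k + 1).factorial : ℝ)))
      (-(F (j + 1 + k) a * ((a - y) ^ k / (k.factorial : ℝ)))) y := by
    intro k
    have h := ((((hasDerivAt_id y).const_sub a).pow (k + 1)).div_const
      ((k + 1).factorial : ℝ)).const_mul (F (j + (k + 1)) a)
    refine h.congr_deriv ?_
    rw [show j + 1 + k = j + (k + 1) by ring]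
    have : (k.factorial : ℝ) ≠ 0 := by positivity
    have : (k + 1 : ℝ) ≠ 0 := by positivity
    rw [Nat.factorial_succ]
    push_cast
    simp only [id]
    field_simp
  have h2 := HasDerivAt.fun_sum (u := Finset.range K) (fun k _ => h1 k)
  have h3 := ((hd j y hy).sub h2).sub_const (F (j + 0) a * 1)
  have he : cmRem F a (K + 1) j = fun y => (F j y - ∑ k ∈ Finset.range K, F (j + (k + 1)) a * ((a - y) ^ (k + 1) / ((k + 1).factorial : ℝ))) - F (j + 0) a * 1 := by
    funext z
    unfold cmRem
    rw [Finset.sum_range_succ']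
    simp
    ring
  rw [he]
  refine HasDerivAt.congr_deriv h3 ?_
  unfold cmRem
  rw [Finset.sum_neg_distrib]
  ring

lemma cmRem_nonneg (F : ℕ → ℝ → ℝ) (h0 : ∀ j t, 0 < t → 0 ≤ F j t)
    (hd : ∀ j t, 0 < t → HasDerivAt (F j) (-(F (j + 1) t)) t) (a : ℝ) (K : ℕ) :
    ∀ (j : ℕ) (y : ℝ), 0 < y → y ≤ a → 0 ≤ cmRem F a K j y := by
  induction K with
  | zero => intro j y hy _; simpa [cmRem] using h0 j y hy
  | succ K ih =>
    intro j y hy hya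
    rw [← cmRem_self F a K j]
    have := antitoneOn_of_hasDerivWithinAt_nonpos (D := Set.Icc y a) (convex_Icc y a)
      (f := cmRem F a (K + 1) j) (f' := fun z => -(cmRem F a K (j + 1) z))
      (fun z hz => (cmRem_hasDerivAt F hd a K j z (lt_of_lt_of_le hy hz.1)).continuousAt.continuousWithinAt)
      (fun z hz => by
        have hz := interior_subset hz
        exact (cmRem_hasDerivAt F hd a K j z (lt_of_lt_of_le hy hz.1)).hasDerivWithinAt)
      (fun z hz => by
        have hz := interior_subset hz
        have := ih (j + 1) z (lt_of_lt_of_le hy hz.1) hz.2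
        linarith)
    exact this ⟨le_refl _, hya⟩ ⟨hya, le_refl _⟩ hya

lemma cm_antitone (F : ℕ → ℝ → ℝ) (h0 : ∀ j t, 0 < t → 0 ≤ F j t)
    (hd : ∀ j t, 0 < t → HasDerivAt (F j) (-(F (j + 1) t)) t) (j : ℕ) :
    AntitoneOn (F j) (Set.Ioi 0) := by
  refine antitoneOn_of_hasDerivWithinAt_nonpos (convex_Ioi 0) (f' := fun z => -(F (j + 1) z))
    (fun z hz => (hd j z hz).continuousAt.continuousWithinAt) ?_ ?_
  · intro z hz
    exact (hd j z (interior_subset hz)).hasDerivWithinAt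
  · intro z hz
    have := h0 (j + 1) z (interior_subset hz)
    linarith

lemma cmRem_le (F : ℕ → ℝ → ℝ) (h0 : ∀ j t, 0 < t → 0 ≤ F j t)
    (hd : ∀ j t, 0 < t → HasDerivAt (F j) (-(F (j + 1) t)) t) (a q : ℝ) (hq : 0 ≤ q) (hq1 : q ≤ 1)
    (K : ℕ) : ∀ (j : ℕ) (s : ℝ), 0 ≤ s → s < a →
      cmRem F a K j (a - q * s) ≤ q ^ K * cmRem F a K j (a - s) := by
  induction K with
  | zero =>
    intro j s hs hsa
    have : q * s ≤ s := by nlinarith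
    simpa [cmRem] using cm_antitone F h0 hd j (show a - s ∈ Set.Ioi 0 by simpa using hsa)
      (show a - q * s ∈ Set.Ioi 0 by simp; linarith) (by linarith)
  | succ K ih =>
    intro j s hs hsa
    have key : ∀ z ∈ Set.Icc 0 s, HasDerivAt
        (fun z => q ^ (K + 1) * cmRem F a (K + 1) j (a - z) - cmRem F a (K + 1) j (a - q * z))
        (q * (q ^ K * cmRem F a K (j + 1) (a - z) - cmRem F a K (j + 1) (a - q * z))) z := by
      intro z hz
      have hqz : q * z ≤ z := by nlinarith [hz.1]
      have e1 := (cmRem_hasDerivAt F hd a K j (a - z) (by linarith [hz.2])).comp z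
        ((hasDerivAt_id z).const_sub a)
      have e2 := (cmRem_hasDerivAt F hd a K j (a - q * z) (by linarith [hz.2])).comp z
        (((hasDerivAt_id z).const_mul q).const_sub a)
      refine ((e1.const_mul (q ^ (K + 1))).sub e2).congr_deriv ?_
      ring
    have mono := monotoneOn_of_hasDerivWithinAt_nonneg (convex_Icc 0 s)
      (fun z hz => (key z hz).continuousAt.continuousWithinAt)
      (fun z hz => (key z (interior_subset hz)).hasDerivWithinAt)
      (fun z hz => by
        have hz := interior_subset hz
        have := ih (j + 1) z hz.1 (lt_of_le_of_lt hz.2 hsa)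
        exact mul_nonneg hq (by linarith))
    have := mono (⟨le_refl _, hs⟩ : (0:ℝ) ∈ Set.Icc 0 s) ⟨hs, le_refl _⟩ hs
    simp only [sub_zero, mul_zero, cmRem_self] at this
    linarith

lemma cm_taylor (F : ℕ → ℝ → ℝ) (h0 : ∀ j t, 0 < t → 0 ≤ F j t)
    (hd : ∀ j t, 0 < t → HasDerivAt (F j) (-(F (j + 1) t)) t) (a y : ℝ) (hy : 0 < y) (hya : y ≤ a) :
    Filter.Tendsto (fun K => ∑ k ∈ Finset.range K, F k a * ((a - y) ^ k / (k.factorial : ℝ)))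
      Filter.atTop (nhds (F 0 y)) := by
  have hs : 0 < a - y / 2 := by linarith
  set q := (a - y) / (a - y / 2) with hqdef
  have hq0 : 0 ≤ q := div_nonneg (by linarith) hs.le
  have hq1 : q < 1 := by rw [hqdef, div_lt_one hs]; linarith
  have hqs : q * (a - y / 2) = a - y := div_mul_cancel₀ _ hs.ne'
  have hR : Filter.Tendsto (fun K => cmRem F a K 0 y) Filter.atTop (nhds 0) := by
    refine squeeze_zero (fun K => cmRem_nonneg F h0 hd a K 0 y hy hya)
      (g := fun K => q ^ K * F 0 (y / 2)) (fun K => ?_) ?_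
    · have := cmRem_le F h0 hd a q hq0 hq1.le K 0 (a - y / 2) hs.le (by linarith)
      rw [hqs] at this
      simp only [sub_sub_cancel] at this
      refine this.trans ?_
      refine mul_le_mul_of_nonneg_left ?_ (pow_nonneg hq0 K)
      unfold cmRem
      rw [sub_le_self_iff]
      refine Finset.sum_nonneg fun k _ => mul_nonneg (h0 _ _ (by linarith)) ?_
      have : 0 ≤ a - y / 2 := hs.le
      positivity
    · simpa using (tendsto_pow_atTop_nhds_zero_of_lt_one hq0 hq1).mul_const (F 0 (y / 2))
  have := (tendsto_const_nhds (x := F 0 y)).sub hR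
  simpa [cmRem] using this

lemma cm_family (f : ℝ → ℝ) (hf : CompletelyMonotonicOn f) :
    ∃ F : ℕ → ℝ → ℝ, F 0 = f ∧ (∀ j t, 0 < t → 0 ≤ F j t) ∧
      (∀ j t, 0 < t → HasDerivAt (F j) (-(F (j + 1) t)) t) := by
  refine ⟨fun j t => (-1 : ℝ) ^ j * iteratedDerivWithin j f (Set.Ioi 0) t, ?_, hf.2.2, ?_⟩
  · funext t; simp
  · intro j t ht
    have hdiff : DifferentiableWithinAt ℝ (iteratedDerivWithin j f (Set.Ioi 0)) (Set.Ioi 0) t :=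
      (hf.2.1.differentiableOn_iteratedDerivWithin (by exact_mod_cast ENat.natCast_lt_top j)
        isOpen_Ioi.uniqueDiffOn) t ht
    have := hdiff.hasDerivWithinAt
    rw [← iteratedDerivWithin_succ] at this
    have := (this.hasDerivAt (isOpen_Ioi.mem_nhds ht)).const_mul ((-1 : ℝ) ^ j)
    refine this.congr_deriv ?_
    ring

/-- Image of the monomial of index `k` under the substitution given by `g`. -/
noncomputable def symPoly (n : ℕ) (g : Matrix (Fin 2) (Fin 2) ℂ) (k : ℕ) : Polynomial ℂ :=
  (Polynomial.C (g 0 0) * Polynomial.X + Polynomial.C (g 1 0)) ^ k *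
    (Polynomial.C (g 0 1) * Polynomial.X + Polynomial.C (g 1 1)) ^ (n - k)

/-- The matrix of the `n`-th symmetric power of `g`. -/
noncomputable def symMat (n : ℕ) (g : Matrix (Fin 2) (Fin 2) ℂ) :
    Matrix (Fin (n + 1)) (Fin (n + 1)) ℂ :=
  Matrix.of fun j k => (symPoly n g k).coeff j

lemma symPoly_eval (n : ℕ) (g : Matrix (Fin 2) (Fin 2) ℂ) (k : ℕ) (z : ℂ) :
    (symPoly n g k).eval z = (g 0 0 * z + g 1 0) ^ k * (g 0 1 * z + g 1 1) ^ (n - k) := by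
  simp [symPoly]

lemma symPoly_natDegree (n : ℕ) (g : Matrix (Fin 2) (Fin 2) ℂ) (k : ℕ) (hk : k ≤ n) :
    (symPoly n g k).natDegree ≤ n := by
  unfold symPoly
  refine Polynomial.natDegree_mul_le.trans ?_
  have h1 := Polynomial.natDegree_pow_le_of_le k
    (Polynomial.natDegree_linear_le (a := g 0 0) (b := g 1 0))
  have h2 := Polynomial.natDegree_pow_le_of_le (n - k)
    (Polynomial.natDegree_linear_le (a := g 0 1) (b := g 1 1))
  omega

lemma symPoly_eval_sum (n : ℕ) (g : Matrix (Fin 2) (Fin 2) ℂ) (k : Fin (n + 1)) (z : ℂ) :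
    (symPoly n g k).eval z = ∑ j : Fin (n + 1), symMat n g j k * z ^ (j : ℕ) := by
  rw [Polynomial.eval_eq_sum_range' (n := n + 1)
    (by have := symPoly_natDegree n g k (by omega); omega), Finset.sum_range]
  rfl

lemma sym_expand (n : ℕ) (g : Matrix (Fin 2) (Fin 2) ℂ) (k : Fin (n + 1)) (u v : ℂ) :
    (g 0 0 * u + g 1 0 * v) ^ (k : ℕ) * (g 0 1 * u + g 1 1 * v) ^ (n - (k : ℕ)) =
      ∑ j : Fin (n + 1), symMat n g j k * (u ^ (j : ℕ) * v ^ (n - (j : ℕ))) := by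
  have hdense : Dense {v : ℂ | v ≠ 0} := dense_compl_singleton 0
  have := Continuous.ext_on hdense
    (f := fun v => (g 0 0 * u + g 1 0 * v) ^ (k : ℕ) * (g 0 1 * u + g 1 1 * v) ^ (n - (k : ℕ)))
    (g := fun v => ∑ j : Fin (n + 1), symMat n g j k * (u ^ (j : ℕ) * v ^ (n - (j : ℕ))))
    (by fun_prop) (by fun_prop) ?_
  · exact congrFun this v
  · intro w hw
    have hw : w ≠ 0 := hw
    have h := symPoly_eval_sum n g k (u / w)
    rw [symPoly_eval] at h
    have e1 : g 0 0 * u + g 1 0 * w = w * (g 0 0 * (u / w) + g 1 0) := by field_simp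
    have e2 : g 0 1 * u + g 1 1 * w = w * (g 0 1 * (u / w) + g 1 1) := by field_simp
    have hk : w ^ n = w ^ (k : ℕ) * w ^ (n - (k : ℕ)) := by
      rw [← pow_add]; congr 1; omega
    simp only
    rw [e1, e2, mul_pow, mul_pow]
    calc _ = w ^ n * ((g 0 0 * (u / w) + g 1 0) ^ (k : ℕ) * (g 0 1 * (u / w) + g 1 1) ^ (n - (k : ℕ))) := by
          rw [hk]; ring
      _ = _ := by
        rw [h, Finset.mul_sum]
        refine Finset.sum_congr rfl fun j _ => ?_
        have hj : w ^ n = w ^ (j : ℕ) * w ^ (n - (j : ℕ)) := by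
          rw [← pow_add]; congr 1; omega
        rw [hj, div_pow]
        field_simp

lemma coeff_unique (n : ℕ) (a b : Fin (n + 1) → ℂ)
    (h : ∀ z : ℂ, ∑ j, a j * z ^ (j : ℕ) = ∑ j, b j * z ^ (j : ℕ)) : a = b := by
  have hp : (∑ j : Fin (n + 1), Polynomial.C (a j) * Polynomial.X ^ (j : ℕ)) =
      ∑ j : Fin (n + 1), Polynomial.C (b j) * Polynomial.X ^ (j : ℕ) := by
    refine Polynomial.funext fun z => ?_
    simpa [Polynomial.eval_finsetSum] using h z
  funext i
  have := congrArg (fun p => Polynomial.coeff p (i : ℕ)) hp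
  simpa [Polynomial.finsetSum_coeff, Polynomial.coeff_X_pow, Fin.val_inj] using this

lemma symMat_mul (n : ℕ) (g h : Matrix (Fin 2) (Fin 2) ℂ) :
    symMat n (g * h) = symMat n g * symMat n h := by
  ext j k
  have := coeff_unique n (fun j => symMat n (g * h) j k) (fun j => (symMat n g * symMat n h) j k) ?_
  · exact congrFun this j
  · intro z
    rw [← symPoly_eval_sum, symPoly_eval]
    have e := sym_expand n h k (g 0 0 * z + g 1 0) (g 0 1 * z + g 1 1)
    simp only [Matrix.mul_apply, Fin.sum_univ_two, Finset.sum_mul]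
    rw [Finset.sum_comm]
    calc _ = _ := by congr 1 <;> ring
      _ = _ := e
      _ = _ := by
        refine Finset.sum_congr rfl fun l _ => ?_
        rw [← symPoly_eval, symPoly_eval_sum, Finset.mul_sum]
        refine Finset.sum_congr rfl fun i _ => ?_
        ring

lemma sym_binom (n : ℕ) (g : Matrix (Fin 2) (Fin 2) ℂ) (y z : ℂ) :
    ∑ k : Fin (n + 1), (∑ j : Fin (n + 1), (n.choose k : ℂ) * symMat n g j k * z ^ (j : ℕ)) * y ^ (k : ℕ)
      = (y * (g 0 0 * z + g 1 0) + (g 0 1 * z + g 1 1)) ^ n := by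
  rw [add_pow, Finset.sum_range]
  refine Finset.sum_congr rfl fun k _ => ?_
  simp only [mul_assoc]
  rw [← Finset.mul_sum, ← symPoly_eval_sum, symPoly_eval, mul_pow]
  ring

lemma symMat_transpose (n : ℕ) (g : Matrix (Fin 2) (Fin 2) ℂ) (j k : Fin (n + 1)) :
    (n.choose k : ℂ) * symMat n g j k = (n.choose j : ℂ) * symMat n g.transpose k j := by
  have key : ∀ z : ℂ, (fun k : Fin (n + 1) => ∑ j : Fin (n + 1), (n.choose k : ℂ) * symMat n g j k * z ^ (j : ℕ))
      = fun k : Fin (n + 1) => ∑ j : Fin (n + 1), (n.choose j : ℂ) * symMat n g.transpose k j * z ^ (j : ℕ) := by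
    intro z
    refine coeff_unique n _ _ fun y => ?_
    rw [sym_binom]
    have h2 := sym_binom n g.transpose z y
    simp only [Finset.sum_mul] at h2 ⊢
    rw [Finset.sum_comm] at h2
    calc _ = _ := by simp only [Matrix.transpose_apply]; ring
      _ = _ := h2.symm
      _ = _ := by
        refine Finset.sum_congr rfl fun k _ => Finset.sum_congr rfl fun j _ => ?_
        ring
  exact congrFun (coeff_unique n (fun j => (n.choose k : ℂ) * symMat n g j k)
    (fun j => (n.choose j : ℂ) * symMat n g.transpose k j) (fun z => congrFun (key z) k)) j

lemma symMat_star (n : ℕ) (g : Matrix (Fin 2) (Fin 2) ℂ) (j k : Fin (n + 1)) :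
    symMat n (g.map (starRingEnd ℂ)) j k = starRingEnd ℂ (symMat n g j k) := by
  have : symPoly n (g.map (starRingEnd ℂ)) k = (symPoly n g k).map (starRingEnd ℂ) := by
    simp [symPoly]
  simp [symMat, this]

lemma symMat_conjTranspose (n : ℕ) (g : Matrix (Fin 2) (Fin 2) ℂ) (j k : Fin (n + 1)) :
    symMat n g.conjTranspose k j =
      ((n.choose k : ℂ) / (n.choose j : ℂ)) * starRingEnd ℂ (symMat n g j k) := by
  have h := symMat_transpose n (g.map (starRingEnd ℂ)) j k
  rw [symMat_star] at h
  have hj : (n.choose j : ℂ) ≠ 0 := by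
    exact_mod_cast (Nat.choose_pos (by omega)).ne'
  have e : (g.map (starRingEnd ℂ)).transpose = g.conjTranspose := rfl
  rw [e] at h
  field_simp
  rw [h]; ring

lemma symMat_trace_upper (n : ℕ) (g : Matrix (Fin 2) (Fin 2) ℂ) (hc : g 1 0 = 0) :
    (symMat n g).trace = ∑ k : Fin (n + 1), g 0 0 ^ (k : ℕ) * g 1 1 ^ (n - (k : ℕ)) := by
  refine Finset.sum_congr rfl fun k _ => ?_
  simp only [Matrix.diag_apply, symMat, Matrix.of_apply, symPoly, hc, map_zero, add_zero, mul_pow]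
  rw [← Polynomial.C_pow, mul_assoc, Polynomial.coeff_C_mul]
  congr 1
  have := Polynomial.coeff_X_pow_mul ((Polynomial.C (g 0 1) * Polynomial.X + Polynomial.C (g 1 1)) ^ (n - (k:ℕ))) (k : ℕ) 0
  rw [zero_add] at this
  rw [this, Polynomial.coeff_zero_eq_eval_zero]
  simp

lemma symMat_trace (n : ℕ) (g : Matrix (Fin 2) (Fin 2) ℂ) (l m : ℂ)
    (ht : g 0 0 + g 1 1 = l + m) (hd : g 0 0 * g 1 1 - g 0 1 * g 1 0 = l * m) :
    (symMat n g).trace = ∑ k : Fin (n + 1), l ^ (k : ℕ) * m ^ (n - (k : ℕ)) := by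
  by_cases hc : g 1 0 = 0
  · rw [symMat_trace_upper n g hc]
    rw [hc, mul_zero, sub_zero] at hd
    have : (g 0 0 - l) * (g 0 0 - m) = 0 := by linear_combination g 0 0 * ht - hd
    rcases mul_eq_zero.1 this with h | h
    · have h1 : g 0 0 = l := by linear_combination h
      have h2 : g 1 1 = m := by linear_combination ht - h
      rw [h1, h2]
    · have h1 : g 0 0 = m := by linear_combination h
      have h2 : g 1 1 = l := by linear_combination ht - h
      rw [h1, h2, ← Equiv.sum_comp Fin.revPerm]
      refine Finset.sum_congr rfl fun k _ => ?_
      rw [Fin.revPerm_apply, Fin.val_rev, mul_comm]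
      congr 2 <;> omega
  · set c := g 1 0 with hcdef
    let P : Matrix (Fin 2) (Fin 2) ℂ := !![l - g 1 1, 1; c, 0]
    let Q : Matrix (Fin 2) (Fin 2) ℂ := !![0, 1 / c; 1, - (l - g 1 1) / c]
    let T : Matrix (Fin 2) (Fin 2) ℂ := !![l, 1; 0, m]
    have hg : g = P * T * Q := by
      ext i j
      fin_cases i <;> fin_cases j <;> simp [P, Q, T, Matrix.mul_apply, Fin.sum_univ_two]
      · linear_combination ht
      · field_simp
        linear_combination -hd + g 1 1 * ht
      · exact hcdef.symm
      · field_simp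
        ring
    have hQP : Q * P = 1 := by
      ext i j
      fin_cases i <;> fin_cases j <;> simp [P, Q, Matrix.mul_apply, Fin.sum_univ_two]
      · field_simp
      · field_simp
        ring
    rw [hg, symMat_mul, Matrix.trace_mul_comm, ← symMat_mul, ← mul_assoc, hQP, one_mul,
      symMat_trace_upper n T (by simp [T])]
    simp [T]

/-- The embedding of `ℝ³` into quaternionic matrices. -/
noncomputable def quatMat (x : EuclideanSpace ℝ (Fin 3)) : Matrix (Fin 2) (Fin 2) ℂ :=
  !![(x 0 : ℂ) + (x 1 : ℂ) * Complex.I, (x 2 : ℂ); -(x 2 : ℂ), (x 0 : ℂ) - (x 1 : ℂ) * Complex.I]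

/-- The character of the `n`-th symmetric power, at angle `θ`. -/
noncomputable def chiC (n : ℕ) (θ : ℝ) : ℂ :=
  ∑ k : Fin (n + 1), Complex.exp (θ * Complex.I) ^ (k : ℕ) *
    Complex.exp (-(θ * Complex.I)) ^ (n - (k : ℕ))

/-- Real part of the character. -/
noncomputable def chi (n : ℕ) (θ : ℝ) : ℝ := (chiC n θ).re

lemma chi_succ (n : ℕ) (θ : ℝ) : chi (n + 2) θ = chi n θ + 2 * Real.cos (((n + 2 : ℕ) : ℝ) * θ) := by
  have h : chiC (n + 2) θ = chiC n θ + (Complex.exp (θ * Complex.I) ^ (n + 2) +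
      Complex.exp (-(θ * Complex.I)) ^ (n + 2)) := by
    have hmul : Complex.exp (θ * Complex.I) * Complex.exp (-(θ * Complex.I)) = 1 := by
      rw [← Complex.exp_add]; simp
    unfold chiC
    rw [Fin.sum_univ_succ, Fin.sum_univ_castSucc]
    have : ∀ k : Fin (n + 1), Complex.exp (θ * Complex.I) ^ ((Fin.succ (Fin.castSucc k) : Fin (n + 2 + 1)) : ℕ) *
      Complex.exp (-(θ * Complex.I)) ^ (n + 2 - ((Fin.succ (Fin.castSucc k) : Fin (n + 2 + 1)) : ℕ)) =
      Complex.exp (θ * Complex.I) ^ (k : ℕ) * Complex.exp (-(θ * Complex.I)) ^ (n - (k : ℕ)) := by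
      intro k
      have e : n + 2 - ((k : ℕ) + 1) = n - (k : ℕ) + 1 := by omega
      simp only [Fin.val_succ, Fin.val_castSucc]
      rw [e, pow_succ, pow_succ]
      linear_combination Complex.exp (θ * Complex.I) ^ (k : ℕ) * Complex.exp (-(θ * Complex.I)) ^ (n - (k : ℕ)) * hmul
    rw [Finset.sum_congr rfl fun k _ => this k]
    simp
    ring
  have h2 : Complex.exp (θ * Complex.I) ^ (n + 2) + Complex.exp (-(θ * Complex.I)) ^ (n + 2) =
      ((2 * Real.cos (((n + 2 : ℕ) : ℝ) * θ) : ℝ) : ℂ) := by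
    rw [← Complex.exp_nat_mul, ← Complex.exp_nat_mul]
    push_cast
    rw [Complex.two_cos]
    congr 2 <;> ring
  unfold chi
  rw [h, h2, Complex.add_re, Complex.ofReal_re]

lemma chi_zero (θ : ℝ) : chi 0 θ = 1 := by simp [chi, chiC]

lemma chi_one (θ : ℝ) : chi 1 θ = 2 * Real.cos θ := by
  have : chiC 1 θ = ((2 * Real.cos θ : ℝ) : ℂ) := by
    simp only [chiC]
    push_cast
    rw [Complex.two_cos]
    simp
    ring_nf
  rw [chi, this, Complex.ofReal_re]

lemma chi_gcDist (n : ℕ) (x y : EuclideanSpace ℝ (Fin 3)) (hx : ‖x‖ = 1) (hy : ‖y‖ = 1) :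
    chiC n (gcDist x y) = (symMat n ((quatMat x).conjTranspose * quatMat y)).trace := by
  have hin : Real.cos (gcDist x y) = x 0 * y 0 + x 1 * y 1 + x 2 * y 2 := by
    have h := abs_real_inner_le_norm x y
    rw [hx, hy, one_mul, abs_le] at h
    rw [gcDist, Real.cos_arccos h.1 h.2]
    simp [PiLp.inner_apply, Fin.sum_univ_three]
    ring
  have hn : ∀ z : EuclideanSpace ℝ (Fin 3), ‖z‖ = 1 → (z 0 : ℂ) ^ 2 + (z 1 : ℂ) ^ 2 + (z 2 : ℂ) ^ 2 = 1 := by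
    intro z hz
    have : z 0 ^ 2 + z 1 ^ 2 + z 2 ^ 2 = 1 := by
      have := EuclideanSpace.real_norm_sq_eq z
      rw [hz, Fin.sum_univ_three] at this
      linarith
    simpa using congrArg Complex.ofReal this
  rw [symMat_trace n _ (Complex.exp (gcDist x y * Complex.I)) (Complex.exp (-(gcDist x y * Complex.I)))]
  · rfl
  · rw [← neg_mul, ← Complex.two_cos, ← Complex.ofReal_cos, hin]
    simp [quatMat, Matrix.mul_apply, Fin.sum_univ_two]
    linear_combination (-2 * (x 1 : ℂ) * (y 1 : ℂ)) * Complex.I_sq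
  · rw [← Complex.exp_add, add_neg_cancel, Complex.exp_zero]
    have hx2 := hn x hx
    have hy2 := hn y hy
    have e1 : (quatMat x).det = 1 := by
      rw [quatMat, Matrix.det_fin_two_of]
      linear_combination hx2 - (x 1 : ℂ) ^ 2 * Complex.I_sq
    have e2 : (quatMat y).det = 1 := by
      rw [quatMat, Matrix.det_fin_two_of]
      linear_combination hy2 - (y 1 : ℂ) ^ 2 * Complex.I_sq
    rw [← Matrix.det_fin_two, Matrix.det_mul, Matrix.det_conjTranspose, e1, e2]
    simp

/-- The sphere as a type. -/
abbrev Sph : Type := Metric.sphere (0 : EuclideanSpace ℝ (Fin 3)) 1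

lemma chi_posdef (n : ℕ) : IsPosDefKernel (fun x y : Sph => chi n (gcDist (x : EuclideanSpace ℝ (Fin 3)) y)) := by
  intro N x c
  have hnorm : ∀ i, ‖(x i : EuclideanSpace ℝ (Fin 3))‖ = 1 := fun i => by
    simp
  have key : (∑ i : Fin N, ∑ j : Fin N, (c i : ℂ) * (c j : ℂ) * chiC n (gcDist (x i : EuclideanSpace ℝ (Fin 3)) (x j)))
      = ∑ k : Fin (n + 1), ∑ l : Fin (n + 1), (((n.choose k : ℝ) / (n.choose l : ℝ) *
        Complex.normSq (∑ i, (c i : ℂ) * symMat n (quatMat (x i)) l k) : ℝ) : ℂ) := by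
    have e : ∀ i j, (c i : ℂ) * (c j : ℂ) * chiC n (gcDist (x i : EuclideanSpace ℝ (Fin 3)) (x j)) =
        ∑ k : Fin (n + 1), ∑ l : Fin (n + 1), ((n.choose k : ℂ) / (n.choose l : ℂ)) *
          ((starRingEnd ℂ ((c i : ℂ) * symMat n (quatMat (x i)) l k)) *
            ((c j : ℂ) * symMat n (quatMat (x j)) l k)) := by
      intro i j
      rw [chi_gcDist n _ _ (hnorm i) (hnorm j), symMat_mul, Matrix.trace, Finset.mul_sum]
      refine Finset.sum_congr rfl fun k _ => ?_
      rw [Matrix.diag_apply, Matrix.mul_apply, Finset.mul_sum]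
      refine Finset.sum_congr rfl fun l _ => ?_
      rw [symMat_conjTranspose, map_mul, Complex.conj_ofReal]
      ring
    have e2 : ∀ k l : Fin (n + 1), (((n.choose k : ℝ) / (n.choose l : ℝ) *
        Complex.normSq (∑ i, (c i : ℂ) * symMat n (quatMat (x i)) l k) : ℝ) : ℂ) =
        ∑ i : Fin N, ∑ j : Fin N, ((n.choose k : ℂ) / (n.choose l : ℂ)) *
          ((starRingEnd ℂ ((c i : ℂ) * symMat n (quatMat (x i)) l k)) *
            ((c j : ℂ) * symMat n (quatMat (x j)) l k)) := by
      intro k l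
      rw [Complex.ofReal_mul, Complex.normSq_eq_conj_mul_self, map_sum, Finset.sum_mul_sum,
        Finset.mul_sum]
      refine Finset.sum_congr rfl fun i _ => ?_
      rw [Finset.mul_sum]
      push_cast
      rfl
    simp_rw [e, e2]
    calc _ = ∑ i : Fin N, ∑ k : Fin (n + 1), ∑ j : Fin N, ∑ l : Fin (n + 1), _ :=
          Finset.sum_congr rfl fun i _ => Finset.sum_comm
      _ = ∑ k : Fin (n + 1), ∑ i : Fin N, ∑ j : Fin N, ∑ l : Fin (n + 1), _ := Finset.sum_comm
      _ = ∑ k : Fin (n + 1), ∑ i : Fin N, ∑ l : Fin (n + 1), ∑ j : Fin N, _ :=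
          Finset.sum_congr rfl fun i _ => Finset.sum_congr rfl fun i _ => Finset.sum_comm
      _ = _ := Finset.sum_congr rfl fun i _ => Finset.sum_comm
  have h2 : (∑ i : Fin N, ∑ j : Fin N, c i * c j * chi n (gcDist (x i : EuclideanSpace ℝ (Fin 3)) (x j)))
      = ∑ k : Fin (n + 1), ∑ l : Fin (n + 1), ((n.choose k : ℝ) / (n.choose l : ℝ) *
        Complex.normSq (∑ i, (c i : ℂ) * symMat n (quatMat (x i)) l k)) := by
    have := congrArg Complex.re key
    rw [← Complex.ofReal_re (∑ k : Fin (n + 1), ∑ l : Fin (n + 1), _)]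
    push_cast at this ⊢
    rw [← this, Complex.re_sum]
    refine Finset.sum_congr rfl fun i _ => ?_
    rw [Complex.re_sum]
    refine Finset.sum_congr rfl fun j _ => ?_
    rw [chi, ← Complex.ofReal_mul, Complex.re_ofReal_mul]
  show 0 ≤ ∑ i : Fin N, ∑ j : Fin N, c i * c j * chi n (gcDist (x i : EuclideanSpace ℝ (Fin 3)) (x j))
  rw [h2]
  refine Finset.sum_nonneg fun k _ => Finset.sum_nonneg fun l _ => ?_
  exact mul_nonneg (by positivity) (Complex.normSq_nonneg _)

lemma pd_tendsto {X : Type*} (K : ℕ → X → X → ℝ) (L : X → X → ℝ) (h : ∀ n, IsPosDefKernel (K n))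
    (hl : ∀ x y, Filter.Tendsto (fun n => K n x y) Filter.atTop (nhds (L x y))) :
    IsPosDefKernel L := by
  intro N x c
  refine ge_of_tendsto' (x := Filter.atTop)
    (f := fun n => ∑ i : Fin N, ∑ j : Fin N, c i * c j * K n (x i) (x j)) ?_ (fun n => h n N x c)
  exact tendsto_finsetSum _ fun i _ => tendsto_finsetSum _ fun j _ => (hl _ _).const_mul _

lemma pd_add {X : Type*} (K L : X → X → ℝ) (h : IsPosDefKernel K) (h' : IsPosDefKernel L) :
    IsPosDefKernel (fun x y => K x y + L x y) := by
  intro N x c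
  have := add_nonneg (h N x c) (h' N x c)
  simpa [mul_add, Finset.sum_add_distrib] using this

lemma pd_smul {X : Type*} (K : X → X → ℝ) (h : IsPosDefKernel K) (a : ℝ) (ha : 0 ≤ a) :
    IsPosDefKernel (fun x y => a * K x y) := by
  intro N x c
  have := mul_nonneg ha (h N x c)
  rw [Finset.mul_sum] at this
  simp_rw [Finset.mul_sum] at this
  refine le_of_le_of_eq this ?_
  refine Finset.sum_congr rfl fun i _ => Finset.sum_congr rfl fun j _ => ?_
  ring

lemma pd_zero {X : Type*} : IsPosDefKernel (fun _ _ : X => (0 : ℝ)) := by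
  intro N x c; simp

lemma pd_sum {X : Type*} (K : ℕ → X → X → ℝ) (h : ∀ n, IsPosDefKernel (K n)) (N : ℕ) :
    IsPosDefKernel (fun x y => ∑ n ∈ Finset.range N, K n x y) := by
  induction N with
  | zero => simpa using pd_zero
  | succ N ih =>
    simp_rw [Finset.sum_range_succ]
    exact pd_add _ _ ih (h N)

lemma pd_comp {X Y : Type*} (K : X → X → ℝ) (h : IsPosDefKernel K) (φ : Y → X) :
    IsPosDefKernel (fun x y => K (φ x) (φ y)) := fun N x c => h N (fun i => φ (x i)) c

lemma pd_matrix {X : Type*} (K : X → X → ℝ) (h : IsPosDefKernel K) (hs : ∀ x y, K x y = K y x)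
    {N : ℕ} (x : Fin N → X) : (Matrix.of fun i j => K (x i) (x j)).PosSemidef := by
  refine Matrix.PosSemidef.of_dotProduct_mulVec_nonneg ?_ ?_
  · ext i j
    simp [hs]
  · intro c
    have := h N x c
    simp only [dotProduct, Matrix.mulVec, Finset.mul_sum, Pi.star_apply, star_trivial,
      Matrix.of_apply]
    refine le_of_le_of_eq this ?_
    refine Finset.sum_congr rfl fun i _ => Finset.sum_congr rfl fun j _ => ?_
    ring

lemma pd_mul {X : Type*} (K L : X → X → ℝ) (h : IsPosDefKernel K) (h' : IsPosDefKernel L)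
    (hs : ∀ x y, K x y = K y x) (hs' : ∀ x y, L x y = L y x) :
    IsPosDefKernel (fun x y => K x y * L x y) := by
  intro N x c
  have := ((pd_matrix K h hs x).hadamard (pd_matrix L h' hs' x)).dotProduct_mulVec_nonneg c
  simp only [dotProduct, Matrix.mulVec, Finset.mul_sum, Pi.star_apply, star_trivial,
      Matrix.of_apply, Matrix.hadamard_apply] at this
  refine le_of_le_of_eq this ?_
  refine Finset.sum_congr rfl fun i _ => Finset.sum_congr rfl fun j _ => ?_
  ring

lemma pd_series (a b : ℕ → ℝ) (ha : ∀ n, 0 ≤ a n) (hmono : ∀ n, a (n + 2) ≤ a n)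
    (hb0 : b 0 = 0) (hb : ∀ n, b (n + 1) = 2 * a (n + 1)) (g : ℝ → ℝ)
    (hg : ∀ θ, 0 ≤ θ → θ ≤ Real.pi → HasSum (fun n : ℕ => b n * Real.cos (n * θ)) (g θ - a 0)) :
    IsPosDefKernel (fun x y : Sph => g (gcDist (x : EuclideanSpace ℝ (Fin 3)) y)) := by
  have part : ∀ (N : ℕ) (θ : ℝ), (∑ n ∈ Finset.range (N + 2), b n * Real.cos (n * θ)) + a 0 =
      (∑ n ∈ Finset.range N, (a n - a (n + 2)) * chi n θ) +
        (a N * chi N θ + a (N + 1) * chi (N + 1) θ) := by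
    intro N θ
    induction N with
    | zero =>
      simp [Finset.sum_range_succ, hb0, chi_zero, chi_one]
      have := hb 0
      simp at this
      rw [this]; ring
    | succ N ih =>
      rw [show N + 1 + 2 = (N + 2) + 1 by ring, Finset.sum_range_succ, add_right_comm, ih,
        Finset.sum_range_succ, show N + 1 + 1 = N + 2 by ring, chi_succ, hb (N + 1)]
      push_cast
      ring_nf
  refine pd_tendsto (fun N (x y : Sph) => (∑ n ∈ Finset.range N, (a n - a (n + 2)) * chi n (gcDist (x : EuclideanSpace ℝ (Fin 3)) y)) +
        (a N * chi N (gcDist (x : EuclideanSpace ℝ (Fin 3)) y) + a (N + 1) * chi (N + 1) (gcDist (x : EuclideanSpace ℝ (Fin 3)) y)))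
    (fun x y : Sph => g (gcDist (x : EuclideanSpace ℝ (Fin 3)) y)) ?_ ?_
  · intro N
    refine pd_add _ _ (pd_sum (fun n (x y : Sph) => (a n - a (n + 2)) * chi n (gcDist (x : EuclideanSpace ℝ (Fin 3)) y)) (fun n => ?_) N) (pd_add _ _ ?_ ?_)
    · exact pd_smul _ (chi_posdef n) _ (by linarith [hmono n])
    · exact pd_smul _ (chi_posdef _) _ (ha _)
    · exact pd_smul _ (chi_posdef _) _ (ha _)
  · intro x y
    simp_rw [← part]
    have h := (hg (gcDist (x : EuclideanSpace ℝ (Fin 3)) y) (Real.arccos_nonneg _) (Real.arccos_le_pi _)).tendsto_sum_nat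
    have h2 := ((Filter.tendsto_add_atTop_iff_nat 2).2 h).add_const (a 0)
    simpa using h2

lemma hasSum_cos2 (x : ℝ) (h0 : 0 ≤ x) (h1 : x ≤ 2 * Real.pi) :
    HasSum (fun n : ℕ => 1 / (n : ℝ) ^ 2 * Real.cos (n * x))
      (x ^ 2 / 4 - Real.pi * x / 2 + Real.pi ^ 2 / 6) := by
  have hp := Real.pi_pos
  have h := hasSum_one_div_nat_pow_mul_cos (k := 1) one_ne_zero (x := x / (2 * Real.pi))
    ⟨by positivity, by rw [div_le_one (by positivity)]; exact h1⟩
  have e := bernoulliFun_two (x / (2 * Real.pi))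
  rw [bernoulliFun] at e
  rw [show 2 * 1 = 2 by norm_num, e] at h
  convert h using 1
  · funext n
    congr 2
    field_simp
  · simp [Nat.factorial]
    field_simp
    ring

lemma hasSum_sin3 (x : ℝ) (h0 : 0 ≤ x) (h1 : x ≤ 2 * Real.pi) :
    HasSum (fun n : ℕ => 1 / (n : ℝ) ^ 3 * Real.sin (n * x))
      (x ^ 3 / 12 - Real.pi * x ^ 2 / 4 + Real.pi ^ 2 * x / 6) := by
  have hp := Real.pi_pos
  have h := hasSum_one_div_nat_pow_mul_sin (k := 1) one_ne_zero (x := x / (2 * Real.pi))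
    ⟨by positivity, by rw [div_le_one (by positivity)]; exact h1⟩
  have e : (Polynomial.map (algebraMap ℚ ℝ) (Polynomial.bernoulli 3)).eval (x / (2 * Real.pi))
      = (x / (2 * Real.pi)) ^ 3 - 3 / 2 * (x / (2 * Real.pi)) ^ 2 + (x / (2 * Real.pi)) / 2 := by
    have h3 : bernoulli 3 = 0 := by rw [bernoulli_eq_bernoulli'_of_ne_one (by norm_num), bernoulli'_three]
    simp [Polynomial.bernoulli_def, Finset.sum_range_succ, h3, Nat.choose]
    ring
  rw [show 2 * 1 + 1 = 3 by norm_num, e] at h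
  convert h using 1
  · funext n
    congr 2
    field_simp
  · simp [Nat.factorial]
    field_simp
    ring

lemma cusa (x : ℝ) (hx : 0 ≤ x) : 3 * Real.sin x ≤ x * (2 + Real.cos x) := by
  rcases le_total x Real.pi with h | h
  · have d1 : ∀ z : ℝ, HasDerivAt (fun z => Real.sin z - z * Real.cos z) (z * Real.sin z) z := by
      intro z
      refine ((Real.hasDerivAt_sin z).sub ((hasDerivAt_id z).mul (Real.hasDerivAt_cos z))).congr_deriv ?_
      simp
    have d2 : ∀ z : ℝ, HasDerivAt (fun z => 2 - 2 * Real.cos z - z * Real.sin z)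
        (Real.sin z - z * Real.cos z) z := by
      intro z
      refine ((((Real.hasDerivAt_cos z).const_mul 2).const_sub 2).sub
        ((hasDerivAt_id z).mul (Real.hasDerivAt_sin z))).congr_deriv ?_
      simp; ring
    have d3 : ∀ z : ℝ, HasDerivAt (fun z => z * (2 + Real.cos z) - 3 * Real.sin z)
        (2 - 2 * Real.cos z - z * Real.sin z) z := by
      intro z
      refine (((hasDerivAt_id z).mul ((Real.hasDerivAt_cos z).const_add 2)).sub
        ((Real.hasDerivAt_sin z).const_mul 3)).congr_deriv ?_
      simp; ring
    have gen : ∀ (F F' : ℝ → ℝ), (∀ z, HasDerivAt F (F' z) z) → F 0 = 0 →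
        (∀ z, 0 ≤ z → z ≤ Real.pi → 0 ≤ F' z) → ∀ z, 0 ≤ z → z ≤ Real.pi → 0 ≤ F z := by
      intro F F' hF h0 hF' z hz hzp
      have := monotoneOn_of_hasDerivWithinAt_nonneg (convex_Icc 0 Real.pi)
        (fun w _ => (hF w).continuousAt.continuousWithinAt)
        (fun w _ => (hF w).hasDerivWithinAt)
        (fun w hw => hF' w (interior_subset hw).1 (interior_subset hw).2)
      rw [← h0]
      exact this ⟨le_refl _, Real.pi_pos.le⟩ ⟨hz, hzp⟩ hz
    have r1 := gen _ _ d1 (by simp) (fun z hz hzp => mul_nonneg hz (Real.sin_nonneg_of_nonneg_of_le_pi hz hzp))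
    have r2 := gen _ _ d2 (by simp) r1
    have r3 := gen _ _ d3 (by simp) r2 x hx h
    linarith
  · have := Real.sin_le_one x
    have := Real.neg_one_le_cos x
    have := Real.pi_gt_three
    nlinarith

lemma h_antitone : AntitoneOn (fun x : ℝ => (x - Real.sin x) / x ^ 3) (Set.Ioi 0) := by
  have key : ∀ x ∈ Set.Ioi (0 : ℝ), HasDerivAt (fun x : ℝ => (x - Real.sin x) / x ^ 3)
      (-((x * (2 + Real.cos x) - 3 * Real.sin x) / x ^ 4)) x := by
    intro x hx
    have hx0 : x ≠ 0 := ne_of_gt hx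
    refine (((hasDerivAt_id x).sub (Real.hasDerivAt_sin x)).div (hasDerivAt_pow 3 x) (by positivity)).congr_deriv ?_
    simp
    field_simp
    ring
  refine antitoneOn_of_hasDerivWithinAt_nonpos (convex_Ioi 0)
    (fun z hz => (key z hz).continuousAt.continuousWithinAt)
    (fun z hz => (key z (interior_subset hz)).hasDerivWithinAt) ?_
  intro z hz
  have hz : 0 < z := interior_subset hz
  have := cusa z hz.le
  have : 0 ≤ (z * (2 + Real.cos z) - 3 * Real.sin z) / z ^ 4 := div_nonneg (by linarith) (by positivity)
  linarith

lemma sub_sin_le (x : ℝ) (hx : 0 ≤ x) : x - Real.sin x ≤ x ^ 3 / 6 := by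
  have key : ∀ z : ℝ, HasDerivAt (fun z => z ^ 3 / 6 - (z - Real.sin z)) (z ^ 2 / 2 - (1 - Real.cos z)) z := by
    intro z
    refine (((hasDerivAt_pow 3 z).div_const 6).sub ((hasDerivAt_id z).sub (Real.hasDerivAt_sin z))).congr_deriv ?_
    simp; ring
  have := monotoneOn_of_hasDerivWithinAt_nonneg (convex_Ici (0 : ℝ))
        (fun w _ => (key w).continuousAt.continuousWithinAt)
        (fun w _ => (key w).hasDerivWithinAt)
        (fun w _ => by linarith [Real.one_sub_sq_div_two_le_cos (x := w)])
  have := this (Set.self_mem_Ici) hx hx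
  simp at this
  linarith

lemma askey_small (t : ℝ) (ht : 0 < t) (htp : t ≤ Real.pi) :
    IsPosDefKernel (fun x y : Sph => (max (t - gcDist (x : EuclideanSpace ℝ (Fin 3)) y) 0) ^ 2) := by
  have hp := Real.pi_pos
  have ha : ∀ n : ℕ, 0 ≤ if n = 0 then t ^ 3 / (3 * Real.pi) else
      2 / Real.pi * ((n * t - Real.sin (n * t)) / (n : ℝ) ^ 3) := by
    intro n
    split_ifs
    · positivity
    · have := Real.sin_le (x := n * t) (by positivity)
      exact mul_nonneg (by positivity) (div_nonneg (by linarith) (by positivity))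
  refine pd_series (fun n => if n = 0 then t ^ 3 / (3 * Real.pi) else
      2 / Real.pi * ((n * t - Real.sin (n * t)) / (n : ℝ) ^ 3))
    (fun n => 4 / Real.pi * ((n * t - Real.sin (n * t)) / (n : ℝ) ^ 3)) ha ?_ (by simp) ?_
    (fun θ => (max (t - θ) 0) ^ 2) ?_
  · intro n
    rcases Nat.eq_zero_or_pos n with rfl | hn
    · have := sub_sin_le (2 * t) (by positivity)
      norm_num
      rw [div_mul_eq_mul_div, div_le_div_iff₀ hp (by positivity)]
      nlinarith
    · have hn' : (0 : ℝ) < n := by exact_mod_cast hn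
      have h := h_antitone (show (n : ℝ) * t ∈ Set.Ioi 0 from mul_pos hn' ht)
        (show ((n + 2 : ℕ) : ℝ) * t ∈ Set.Ioi 0 from by push_cast; exact mul_pos (by linarith) ht)
        (by push_cast; nlinarith)
      have e : ∀ m : ℕ, ((m : ℝ) * t - Real.sin (m * t)) / (m : ℝ) ^ 3 =
          t ^ 3 * (((m : ℝ) * t - Real.sin (m * t)) / ((m : ℝ) * t) ^ 3) := by
        intro m
        rw [mul_pow]
        field_simp
      simp only [hn.ne', if_false, show n + 2 ≠ 0 by omega]
      rw [e, e]
      exact mul_le_mul_of_nonneg_left (mul_le_mul_of_nonneg_left h (by positivity)) (by positivity)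
  · intro n
    simp only [show n + 1 ≠ 0 by omega, if_false]
    ring
  · intro θ h0 h1
    have hC := hasSum_cos2 θ h0 (by linarith)
    have hS := hasSum_sin3 (t + θ) (by linarith) (by linarith)
    have hterm : ∀ n : ℕ, 4 / Real.pi * ((n * t - Real.sin (n * t)) / (n : ℝ) ^ 3) * Real.cos (n * θ) =
        4 / Real.pi * (t * (1 / (n : ℝ) ^ 2 * Real.cos (n * θ)) -
          1 / 2 * (1 / (n : ℝ) ^ 3 * Real.sin (n * (t + θ)) + 1 / (n : ℝ) ^ 3 * Real.sin (n * (t - θ)))) := by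
      intro n
      rcases Nat.eq_zero_or_pos n with rfl | hn
      · simp
      · have hn' : (0 : ℝ) < n := by exact_mod_cast hn
        rw [mul_add (n : ℝ) t θ, mul_sub (n : ℝ) t θ, Real.sin_add, Real.sin_sub]
        field_simp
        ring
    simp_rw [hterm]
    simp only [if_true]
    rcases le_total θ t with h | h
    · have hS2 := hasSum_sin3 (t - θ) (by linarith) (by linarith)
      have := (((hC.mul_left t).sub ((hS.add hS2).mul_left (1 / 2))).mul_left (4 / Real.pi))
      convert! this using 1
      rw [max_eq_left (by linarith)]
      field_simp
      ring
    · have hS2 := (hasSum_sin3 (θ - t) (by linarith) (by linarith)).neg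
      have hS2 : HasSum (fun n : ℕ => 1 / (n : ℝ) ^ 3 * Real.sin (n * (t - θ)))
        (-((θ - t) ^ 3 / 12 - Real.pi * (θ - t) ^ 2 / 4 + Real.pi ^ 2 * (θ - t) / 6)) := by
        convert! hS2 using 1
        funext n
        rw [← mul_neg, ← Real.sin_neg]
        congr 2
        ring
      have := (((hC.mul_left t).sub ((hS.add hS2).mul_left (1 / 2))).mul_left (4 / Real.pi))
      convert! this using 1
      rw [max_eq_right (by linarith)]
      field_simp
      ring

lemma askey_large (t : ℝ) (htp : Real.pi ≤ t) :
    IsPosDefKernel (fun x y : Sph => (max (t - gcDist (x : EuclideanSpace ℝ (Fin 3)) y) 0) ^ 2) := by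
  have hp := Real.pi_pos
  have hs : ∀ n : ℕ, 0 ≤ t - (t - Real.pi) * (-1) ^ n := by
    intro n
    rcases neg_one_pow_eq_or ℝ n with h | h <;> rw [h] <;> linarith
  refine pd_series (fun n => if n = 0 then (t ^ 3 - (t - Real.pi) ^ 3) / (3 * Real.pi) else
      2 / Real.pi * ((t - (t - Real.pi) * (-1) ^ n) / (n : ℝ) ^ 2))
    (fun n => 4 / Real.pi * ((t - (t - Real.pi) * (-1) ^ n) / (n : ℝ) ^ 2)) ?_ ?_ (by simp) ?_
    (fun θ => (max (t - θ) 0) ^ 2) ?_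
  · intro n
    split_ifs
    · refine div_nonneg ?_ (by positivity)
      have : (t - Real.pi) ^ 3 ≤ t ^ 3 := pow_le_pow_left₀ (by linarith) (by linarith) 3
      linarith
    · exact mul_nonneg (by positivity) (div_nonneg (hs n) (by positivity))
  · intro n
    rcases Nat.eq_zero_or_pos n with rfl | hn
    · norm_num
      rw [div_mul_eq_mul_div, div_le_div_iff₀ hp (by positivity)]
      have := Real.pi_gt_three
      nlinarith [mul_pos hp hp, mul_nonneg (sub_nonneg.2 htp) hp.le, mul_nonneg (mul_nonneg (sub_nonneg.2 htp) hp.le) hp.le, mul_nonneg (mul_nonneg (sub_nonneg.2 htp) (sub_nonneg.2 htp)) hp.le, mul_pos (mul_pos hp hp) hp, mul_nonneg (mul_nonneg (mul_nonneg (sub_nonneg.2 htp) hp.le) hp.le) hp.le, mul_pos (mul_pos hp hp) (sub_pos.2 this)]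
    · have hn' : (0 : ℝ) < n := by exact_mod_cast hn
      simp only [hn.ne', if_false, show n + 2 ≠ 0 by omega]
      rw [show (-1 : ℝ) ^ (n + 2) = (-1) ^ n by rw [pow_add]; norm_num]
      refine mul_le_mul_of_nonneg_left (div_le_div_of_nonneg_left (hs n) (by positivity) ?_) (by positivity)
      push_cast
      nlinarith
  · intro n
    simp only [show n + 1 ≠ 0 by omega, if_false]
    ring
  · intro θ h0 h1
    have hC := hasSum_cos2 θ h0 (by linarith)
    have hC2 := hasSum_cos2 (Real.pi + θ) (by linarith) (by linarith)
    have hterm : ∀ n : ℕ, 4 / Real.pi * ((t - (t - Real.pi) * (-1) ^ n) / (n : ℝ) ^ 2) * Real.cos (n * θ) =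
        4 / Real.pi * (t * (1 / (n : ℝ) ^ 2 * Real.cos (n * θ)) -
          (t - Real.pi) * (1 / (n : ℝ) ^ 2 * Real.cos (n * (Real.pi + θ)))) := by
      intro n
      rw [mul_add, add_comm ((n : ℝ) * Real.pi), Real.cos_add_nat_mul_pi]
      ring
    simp_rw [hterm]
    simp only [if_true]
    have := ((hC.mul_left t).sub (hC2.mul_left (t - Real.pi))).mul_left (4 / Real.pi)
    convert! this using 1
    rw [max_eq_left (by linarith)]
    field_simp
    ring

lemma askey (ξ r : ℝ) (hξ : 0 < ξ) (hr : 0 ≤ r) :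
    IsPosDefKernel (fun x y : Sph => (max (ξ - r * gcDist (x : EuclideanSpace ℝ (Fin 3)) y) 0) ^ 2) := by
  rcases hr.eq_or_lt with rfl | hr
  · intro N x c
    simp only [zero_mul, sub_zero]
    rw [max_eq_left hξ.le]
    simp_rw [← Finset.sum_mul, ← Finset.mul_sum]
    rw [← Finset.sum_mul]
    have := mul_self_nonneg (∑ i, c i)
    positivity
  · have h : IsPosDefKernel (fun x y : Sph => (max (ξ / r - gcDist (x : EuclideanSpace ℝ (Fin 3)) y) 0) ^ 2) := by
      rcases le_total (ξ / r) Real.pi with h | h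
      · exact askey_small _ (by positivity) h
      · exact askey_large _ h
    have := pd_smul _ h (r ^ 2) (by positivity)
    convert this using 3 with x y
    rw [← mul_pow, mul_max_of_nonneg _ _ hr.le, mul_zero, mul_sub]
    congr 3
    field_simp

lemma gamma_int (γ A : ℝ) (hγ : 0 < γ) :
    MeasureTheory.Integrable (fun ξ : ℝ => Real.exp (-ξ * γ) * (max (ξ - A) 0) ^ 2) ∧
    ∫ ξ : ℝ, Real.exp (-ξ * γ) * (max (ξ - A) 0) ^ 2 = 2 * (Real.exp (-(A * γ)) / γ ^ 3) := by
  set φ : ℝ → ℝ := fun s => s ^ 2 * Real.exp (-(γ * s)) with hφ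
  have hI : ∫ s in Set.Ioi (0 : ℝ), φ s = 2 / γ ^ 3 := by
    have h := Real.integral_rpow_mul_exp_neg_mul_Ioi (a := 3) (r := γ) (by norm_num) hγ
    have hG : Real.Gamma 3 = 2 := by
      have := Real.Gamma_nat_eq_factorial 2
      rw [show ((2 : ℕ) : ℝ) + 1 = 3 by norm_num] at this
      rw [this]; norm_num [Nat.factorial]
    rw [hG] at h
    have e : ∀ s : ℝ, s ^ ((3 : ℝ) - 1) = s ^ 2 := by
      intro s
      rw [show (3 : ℝ) - 1 = (2 : ℕ) by norm_num, Real.rpow_natCast]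
    simp_rw [e] at h
    rw [hφ, h, show (3 : ℝ) = (3 : ℕ) by norm_num, Real.rpow_natCast]
    field_simp
  have hintg : MeasureTheory.IntegrableOn φ (Set.Ioi 0) := by
    by_contra hc
    have := MeasureTheory.integral_undef hc
    rw [hI] at this
    have h2 : 0 < 2 / γ ^ 3 := by positivity
    linarith
  have hintg' := (MeasureTheory.integrable_indicator_iff measurableSet_Ioi).2 hintg
  have e : (fun ξ : ℝ => Real.exp (-ξ * γ) * (max (ξ - A) 0) ^ 2) =
      fun ξ => Real.exp (-(A * γ)) * (Set.Ioi (0 : ℝ)).indicator φ (ξ - A) := by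
    funext ξ
    by_cases h : 0 < ξ - A
    · rw [Set.indicator_of_mem (show ξ - A ∈ Set.Ioi 0 from h), max_eq_left h.le, hφ]
      simp only
      rw [mul_left_comm, ← Real.exp_add, mul_comm]
      congr 2
      ring
    · rw [Set.indicator_of_notMem (show ξ - A ∉ Set.Ioi 0 from h), max_eq_right (not_lt.1 h)]
      simp
  rw [e]
  refine ⟨(hintg'.comp_sub_right A).const_mul _, ?_⟩
  rw [MeasureTheory.integral_const_mul,
    MeasureTheory.integral_sub_right_eq_self (fun s => (Set.Ioi (0 : ℝ)).indicator φ s) A,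
    MeasureTheory.integral_indicator measurableSet_Ioi, hI]
  ring

lemma gcDist_nonneg (x y : EuclideanSpace ℝ (Fin 3)) : 0 ≤ gcDist x y := Real.arccos_nonneg _

lemma gcDist_comm (x y : EuclideanSpace ℝ (Fin 3)) : gcDist x y = gcDist y x := by
  rw [gcDist, gcDist, real_inner_comm]

lemma exp_posdef (γT : ℝ → ℝ) (hγeven : ∀ u : ℝ, γT (-u) = γT u)
    (hγge : ∀ u : ℝ, 1 ≤ γT u)
    (hγpd : ∀ ξ : ℝ, 0 < ξ →
      IsPosDefKernel (fun t₁ t₂ : ℝ => Real.exp (-ξ * γT (t₁ - t₂)))) (r : ℝ) (hr : 0 ≤ r) :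
    IsPosDefKernel (fun p q : Sph × ℝ =>
      Real.exp (-(r * gcDist (p.1 : EuclideanSpace ℝ (Fin 3)) q.1 * γT (p.2 - q.2))) /
        γT (p.2 - q.2) ^ 3) := by
  have hsym : ∀ u v : ℝ, γT (u - v) = γT (v - u) := fun u v => by rw [← hγeven, neg_sub]
  have hpd : ∀ ξ : ℝ, IsPosDefKernel (fun p q : Sph × ℝ => Real.exp (-ξ * γT (p.2 - q.2)) *
      (max (ξ - r * gcDist (p.1 : EuclideanSpace ℝ (Fin 3)) q.1) 0) ^ 2) := by
    intro ξ
    rcases lt_or_ge 0 ξ with h | h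
    · refine pd_mul (fun p q : Sph × ℝ => Real.exp (-ξ * γT (p.2 - q.2)))
        (fun p q : Sph × ℝ => (max (ξ - r * gcDist (p.1 : EuclideanSpace ℝ (Fin 3)) q.1) 0) ^ 2)
        (pd_comp _ (hγpd ξ h) Prod.snd) (pd_comp _ (askey ξ r h hr) Prod.fst) ?_ ?_
      · intro p q
        simp only [hsym p.2 q.2]
      · intro p q
        simp only [gcDist_comm (p.1 : EuclideanSpace ℝ (Fin 3)) q.1]
    · have : ∀ p q : Sph × ℝ, Real.exp (-ξ * γT (p.2 - q.2)) *
          (max (ξ - r * gcDist (p.1 : EuclideanSpace ℝ (Fin 3)) q.1) 0) ^ 2 = 0 := by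
        intro p q
        have := mul_nonneg hr (gcDist_nonneg (p.1 : EuclideanSpace ℝ (Fin 3)) q.1)
        rw [max_eq_right (by linarith)]
        simp
      simp_rw [this]
      exact pd_zero
  intro N x c
  have hG := fun i j : Fin N => gamma_int (γT ((x i).2 - (x j).2))
    (r * gcDist ((x i).1 : EuclideanSpace ℝ (Fin 3)) (x j).1) (by linarith [hγge ((x i).2 - (x j).2)])
  have h0 : 0 ≤ ∫ ξ : ℝ, (∑ i : Fin N, ∑ j : Fin N, c i * c j *
      (Real.exp (-ξ * γT ((x i).2 - (x j).2)) *
      (max (ξ - r * gcDist ((x i).1 : EuclideanSpace ℝ (Fin 3)) (x j).1) 0) ^ 2)) :=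
    MeasureTheory.integral_nonneg (fun ξ => hpd ξ N x c)
  rw [MeasureTheory.integral_finsetSum _ (fun i _ => MeasureTheory.integrable_finsetSum _
    fun j _ => (hG i j).1.const_mul _)] at h0
  have h1 : ∀ i : Fin N, ∫ ξ : ℝ, (∑ j : Fin N, c i * c j *
      (Real.exp (-ξ * γT ((x i).2 - (x j).2)) *
      (max (ξ - r * gcDist ((x i).1 : EuclideanSpace ℝ (Fin 3)) (x j).1) 0) ^ 2)) =
      2 * ∑ j : Fin N, c i * c j * (Real.exp (-(r * gcDist ((x i).1 : EuclideanSpace ℝ (Fin 3)) (x j).1 *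
        γT ((x i).2 - (x j).2))) / γT ((x i).2 - (x j).2) ^ 3) := by
    intro i
    rw [MeasureTheory.integral_finsetSum _ (fun j _ => (hG i j).1.const_mul _), Finset.mul_sum]
    refine Finset.sum_congr rfl fun j _ => ?_
    rw [MeasureTheory.integral_const_mul, (hG i j).2]
    ring
  rw [Finset.sum_congr rfl fun i _ => h1 i, ← Finset.mul_sum] at h0
  linarith

lemma tendsto_approx (x : ℝ) (hx : 0 ≤ x) :
    Filter.Tendsto (fun n : ℕ => 1 / ((n : ℝ) + 1) + ((n : ℝ) + 1) * (1 - Real.exp (-(x / ((n : ℝ) + 1)))))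
      Filter.atTop (nhds x) := by
  have h1 := tendsto_one_div_add_atTop_nhds_zero_nat (𝕜 := ℝ)
  have h2 : Filter.Tendsto (fun n : ℕ => ((n : ℝ) + 1) * (1 - Real.exp (-(x / ((n : ℝ) + 1)))))
      Filter.atTop (nhds x) := by
    refine tendsto_of_tendsto_of_tendsto_of_le_of_le (g := fun n : ℕ => x / (1 + x * (1 / ((n : ℝ) + 1))))
      (h := fun _ => x) ?_ tendsto_const_nhds ?_ ?_
    · have : Filter.Tendsto (fun n : ℕ => x / (1 + x * (1 / ((n : ℝ) + 1)))) Filter.atTop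
          (nhds (x / (1 + x * 0))) :=
        tendsto_const_nhds.div ((h1.const_mul x).const_add 1) (by simp)
      simpa using this
    · intro n
      have hm : (0 : ℝ) < (n : ℝ) + 1 := by positivity
      set m := (n : ℝ) + 1
      have hu : 0 ≤ x / m := by positivity
      have he : Real.exp (-(x / m)) ≤ 1 / (1 + x / m) := by
        rw [Real.exp_neg, ← one_div]
        exact one_div_le_one_div_of_le (by positivity) (by linarith [Real.add_one_le_exp (x / m)])
      have e2 : x / (1 + x * (1 / m)) = m * (1 - 1 / (1 + x / m)) := by
        have : m + x ≠ 0 := by positivity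
        field_simp
        ring
      show x / (1 + x * (1 / m)) ≤ m * (1 - Real.exp (-(x / m)))
      rw [e2]
      exact mul_le_mul_of_nonneg_left (by linarith) hm.le
    · intro n
      have hm : (0 : ℝ) < (n : ℝ) + 1 := by positivity
      set m := (n : ℝ) + 1
      have := Real.add_one_le_exp (-(x / m))
      show m * (1 - Real.exp (-(x / m))) ≤ x
      calc _ ≤ m * (x / m) := mul_le_mul_of_nonneg_left (by linarith) hm.le
        _ = x := by field_simp
  simpa using h1.add h2

/-- The scale-mixture model `ψ(d,u) = (σ²/γ_T(u)³) f(d γ_T(u))` with `f` completely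
monotonic, `f(0) = 1`, and `γ_T ≥ 1` an even continuous function with `γ_T(0) = 1` such
that `exp(-ξ γ_T)` is positive definite for all `ξ > 0`, is a geodesically isotropic,
temporally symmetric covariance function on `𝕊² × ℝ`. -/
theorem scale_mixture_gneiting_posdef
    (σ2 : ℝ) (hσ : 0 < σ2)
    (f : ℝ → ℝ) (hf : CompletelyMonotonicOn f) (hf0 : f 0 = 1)
    (γT : ℝ → ℝ) (hγcont : Continuous γT) (hγeven : ∀ u : ℝ, γT (-u) = γT u)
    (hγge : ∀ u : ℝ, 1 ≤ γT u) (hγ0 : γT 0 = 1)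
    (hγpd : ∀ ξ : ℝ, 0 < ξ →
      IsPosDefKernel (fun t₁ t₂ : ℝ => Real.exp (-ξ * γT (t₁ - t₂)))) :
    IsPosDefKernel (fun p q : Metric.sphere (0 : EuclideanSpace ℝ (Fin 3)) 1 × ℝ =>
      σ2 / γT (p.2 - q.2) ^ 3 *
        f (gcDist (p.1 : EuclideanSpace ℝ (Fin 3)) (q.1 : EuclideanSpace ℝ (Fin 3)) *
            γT (p.2 - q.2))) := by
  obtain ⟨F, hF0, hFn, hFd⟩ := cm_family f hf
  have hx : ∀ p q : Sph × ℝ, 0 ≤ gcDist (p.1 : EuclideanSpace ℝ (Fin 3)) q.1 * γT (p.2 - q.2) :=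
    fun p q => mul_nonneg (gcDist_nonneg _ _) (by linarith [hγge (p.2 - q.2)])
  -- the approximants
  have step : ∀ n : ℕ, IsPosDefKernel (fun p q : Sph × ℝ => σ2 / γT (p.2 - q.2) ^ 3 *
      f (1 / ((n : ℝ) + 1) + ((n : ℝ) + 1) * (1 - Real.exp (-(gcDist (p.1 : EuclideanSpace ℝ (Fin 3)) q.1 *
        γT (p.2 - q.2) / ((n : ℝ) + 1)))))) := by
    intro n
    have hm : (0 : ℝ) < (n : ℝ) + 1 := by positivity
    set m := (n : ℝ) + 1
    refine pd_tendsto (fun K (p q : Sph × ℝ) => ∑ k ∈ Finset.range K,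
      (σ2 * F k (1 / m + m) * (m ^ k / (k.factorial : ℝ))) *
        (Real.exp (-((k : ℝ) / m * gcDist (p.1 : EuclideanSpace ℝ (Fin 3)) q.1 * γT (p.2 - q.2))) /
          γT (p.2 - q.2) ^ 3)) _ ?_ ?_
    · intro K
      refine pd_sum (fun k (p q : Sph × ℝ) => (σ2 * F k (1 / m + m) * (m ^ k / (k.factorial : ℝ))) *
        (Real.exp (-((k : ℝ) / m * gcDist (p.1 : EuclideanSpace ℝ (Fin 3)) q.1 * γT (p.2 - q.2))) /
          γT (p.2 - q.2) ^ 3)) (fun k => ?_) K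
      refine pd_smul _ (exp_posdef γT hγeven hγge hγpd _ (by positivity)) _ ?_
      exact mul_nonneg (mul_nonneg hσ.le (hFn _ _ (by positivity))) (by positivity)
    · intro p q
      set x := gcDist (p.1 : EuclideanSpace ℝ (Fin 3)) q.1 * γT (p.2 - q.2) with hxdef
      have hx0 : 0 ≤ x := hx p q
      have hle : Real.exp (-(x / m)) ≤ 1 := Real.exp_le_one_iff.2 (by
        have : 0 ≤ x / m := by positivity
        linarith)
      have hpos := Real.exp_pos (-(x / m))
      have h := cm_taylor F hFn hFd (1 / m + m) (1 / m + m * (1 - Real.exp (-(x / m))))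
        (add_pos_of_pos_of_nonneg (by positivity) (mul_nonneg hm.le (by linarith)))
        (by nlinarith)
      rw [hF0] at h
      refine (h.const_mul (σ2 / γT (p.2 - q.2) ^ 3)).congr fun K => ?_
      rw [Finset.mul_sum]
      refine Finset.sum_congr rfl fun k _ => ?_
      have e1 : 1 / m + m - (1 / m + m * (1 - Real.exp (-(x / m)))) = m * Real.exp (-(x / m)) := by ring
      have e2 : -((k : ℝ) / m * gcDist (p.1 : EuclideanSpace ℝ (Fin 3)) q.1 * γT (p.2 - q.2)) =
          (k : ℝ) * (-(x / m)) := by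
        rw [hxdef]; ring
      rw [e1, e2, mul_pow, Real.exp_nat_mul]
      ring
  refine pd_tendsto _ _ step fun p q => ?_
  refine Filter.Tendsto.const_mul _ ?_
  have h := tendsto_approx _ (hx p q)
  refine (hf.1 _ (hx p q)).tendsto.comp (tendsto_nhdsWithin_iff.2 ⟨h, Filter.Eventually.of_forall fun n => ?_⟩)
  have hm : (0 : ℝ) < (n : ℝ) + 1 := by positivity
  have hle : Real.exp (-(gcDist (p.1 : EuclideanSpace ℝ (Fin 3)) q.1 * γT (p.2 - q.2) / ((n : ℝ) + 1))) ≤ 1 :=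
    Real.exp_le_one_iff.2 (by
      have := div_nonneg (hx p q) hm.le
      linarith)
  exact add_nonneg (by positivity) (mul_nonneg hm.le (by linarith))
end
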